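/- arXiv:1201.0941 — 5 statements merged into one kernel-verified Lean document; each statement's English description precedes it below -/
import Mathlib

section
/- For every c > 0 there exist constants C₁, C₂ > 0 (depending only on c) with the following property. Let d ≥ 1, let X ⊆ (Fin d)^ℤ be a nonempty closed shift-invariant set on which the left shift S acts minimally (every S-orbit {S^n w : n ∈ ℤ} is dense in X), and let μ be an S-invariant Borel probability measure on X. For n ≥ 1 let ε_n be the minimum of μ(C_b) over all allowed n-blocks b. Suppose (n_i)_{i≥1} is a sequence of positive integers with n_i > 10·n_{i−1} for all i ≥ 2 and ε_{n_i} > c / n_i for all i. Then for every i ≥ 1, every L ≥ 0, every allowed block b of length n_i, and all w, w' ∈ X: (1/n_{i+L}) · | Σ_{j=1}^{n_{i+L}} ( χ_b(S^j w) − χ_b(S^j w') ) | < C₁ · e^{−C₂ L}. -/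
open MeasureTheory Filter Set

/-- The left shift on bi-infinite sequences. -/
def shiftS (d : ℕ) : (ℤ → Fin d) → (ℤ → Fin d) := fun w k => w (k + 1)

/-- Shift by an arbitrary integer `m`. -/
def shiftZ (d : ℕ) (m : ℤ) : (ℤ → Fin d) → (ℤ → Fin d) := fun w k => w (k + m)

/-- The cylinder set of a block `b` of length `n` inside `X`. -/
def cyl {d : ℕ} (X : Set (ℤ → Fin d)) {n : ℕ} (b : Fin n → Fin d) : Set (ℤ → Fin d) :=
  {w ∈ X | ∀ k : Fin n, w ((k : ℕ) : ℤ) = b k}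

/-- Indicator function `χ_b`: it is `1` at `w` iff the block `b` occurs in `w` at position `0`. -/
def blockInd {d n : ℕ} (b : Fin n → Fin d) (w : ℤ → Fin d) : ℝ :=
  if ∀ k : Fin n, w ((k : ℕ) : ℤ) = b k then 1 else 0

namespace Bosh

lemma iter_apply {d : ℕ} (j : ℕ) (w : ℤ → Fin d) (k : ℤ) :
    (shiftS d)^[j] w k = w (k + j) := by
  induction j generalizing w with
  | zero => simp
  | succ j ih =>
    rw [Function.iterate_succ_apply, ih]
    simp only [shiftS]
    congr 1
    push_cast
    ring

lemma shiftZ_nat {d : ℕ} (j : ℕ) (w : ℤ → Fin d) : shiftZ d j w = (shiftS d)^[j] w := by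
  funext k
  rw [iter_apply]
  rfl

lemma iter_shiftZ {d : ℕ} (j : ℕ) (m : ℤ) (w : ℤ → Fin d) :
    (shiftS d)^[j] (shiftZ d m w) = shiftZ d (m + j) w := by
  funext k
  rw [iter_apply]
  simp only [shiftZ]
  congr 1
  ring

/-- The standing hypotheses on the system. -/
structure Sys (d : ℕ) (X : Set (ℤ → Fin d)) (μ : Measure (ℤ → Fin d)) : Prop where
  inv : ∀ w ∈ X, ∀ m : ℤ, shiftZ d m w ∈ X
  dense : ∀ w ∈ X, X ⊆ closure {v | ∃ m : ℤ, v = shiftZ d m w}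
  prob : IsProbabilityMeasure μ
  null : μ Xᶜ = 0
  mp : MeasurePreserving (shiftS d) μ μ
  closed : IsClosed X

lemma Sys.iter {d : ℕ} {X : Set (ℤ → Fin d)} {μ : Measure (ℤ → Fin d)} (h : Sys d X μ)
    {w : ℤ → Fin d} (hw : w ∈ X) (j : ℕ) : (shiftS d)^[j] w ∈ X := by
  rw [← shiftZ_nat]
  exact h.inv w hw j

lemma Sys.hit {d : ℕ} {X : Set (ℤ → Fin d)} {μ : Measure (ℤ → Fin d)} (h : Sys d X μ)
    {w z : ℤ → Fin d} (hw : w ∈ X) (hz : z ∈ X) (l : ℕ) :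
    ∃ m : ℤ, ∀ k : ℕ, k < l → shiftZ d m w k = z k := by
  have hc := h.dense w hw hz
  rw [mem_closure_iff] at hc
  have ho : IsOpen {v : ℤ → Fin d | ∀ k ∈ Finset.range l, v (k : ℤ) = z k} := by
    have : {v : ℤ → Fin d | ∀ k ∈ Finset.range l, v (k : ℤ) = z k} =
        ⋂ k ∈ Finset.range l, {v : ℤ → Fin d | v (k : ℤ) = z k} := by
      ext v
      simp
    rw [this]
    refine isOpen_biInter_finset fun k _ => ?_
    exact (isOpen_discrete {z (k : ℤ)}).preimage
      (continuous_apply (A := fun _ : ℤ => Fin d) (k : ℤ))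
  obtain ⟨v, hv, m, rfl⟩ := hc _ ho (by simp)
  exact ⟨m, fun k hk => hv k (by simpa using hk)⟩

/-- every allowed block of length `N` has measure more than `c / N` -/
def Eps (d : ℕ) (X : Set (ℤ → Fin d)) (μ : Measure (ℤ → Fin d)) (c : ℝ) (N : ℕ) : Prop :=
  ∀ b : Fin N → Fin d, (cyl X b).Nonempty → c / (N : ℝ) < (μ (cyl X b)).toReal

lemma meas_cyl {d : ℕ} {X : Set (ℤ → Fin d)} (hX : IsClosed X) {N : ℕ} (b : Fin N → Fin d) :
    MeasurableSet (cyl X b) := by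
  have : cyl X b = X ∩ ⋂ k : Fin N, {w : ℤ → Fin d | w ((k : ℕ) : ℤ) = b k} := by
    ext w
    simp [cyl]
  rw [this]
  refine hX.measurableSet.inter (MeasurableSet.iInter fun k => ?_)
  exact (measurable_pi_apply (X := fun _ : ℤ => Fin d) ((k : ℕ) : ℤ))
    (measurableSet_singleton (b k))

/-- disjoint pieces -/
lemma marker_aux {d : ℕ} {μ : Measure (ℤ → Fin d)} [IsProbabilityMeasure μ]
    (mp : MeasurePreserving (shiftS d) μ μ)
    {B U : Set (ℤ → Fin d)} (hB : MeasurableSet B) (hU : MeasurableSet U) {τ a : ℕ}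
    (hsub : ∀ t < τ, ∀ y, (shiftS d)^[t] y ∈ B → (shiftS d)^[a] y ∈ U)
    (hdisj : ∀ s t, s < t → t < τ → ∀ y, (shiftS d)^[s] y ∈ B → (shiftS d)^[t] y ∈ B → False) :
    τ * μ.real B ≤ μ.real U := by
  have h1 : μ.real ((shiftS d)^[a] ⁻¹' U) = μ.real U :=
    (mp.iterate a).measureReal_preimage hU.nullMeasurableSet
  have h2 : μ.real (⋃ t ∈ Finset.range τ, (shiftS d)^[t] ⁻¹' B) =
      ∑ t ∈ Finset.range τ, μ.real ((shiftS d)^[t] ⁻¹' B) := by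
    apply measureReal_biUnion_finset
    · intro s hs t ht hst
      simp only [Finset.coe_range, Set.mem_Iio] at hs ht
      refine Set.disjoint_left.2 fun y hy1 hy2 => ?_
      rcases lt_or_gt_of_ne hst with h | h
      · exact hdisj s t h ht y hy1 hy2
      · exact hdisj t s h hs y hy2 hy1
    · intro t _
      exact (mp.iterate t).measurable hB
    · intro t _
      exact measure_ne_top _ _
  have h3 : ∀ t ∈ Finset.range τ, μ.real ((shiftS d)^[t] ⁻¹' B) = μ.real B := fun t _ =>
    (mp.iterate t).measureReal_preimage hB.nullMeasurableSet
  rw [Finset.sum_congr rfl h3] at h2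
  simp only [Finset.sum_const, Finset.card_range, nsmul_eq_mul] at h2
  rw [← h2, ← h1]
  refine measureReal_mono ?_
  intro y hy
  simp only [Finset.mem_range, Set.mem_iUnion, exists_prop] at hy
  obtain ⟨t, ht, hy⟩ := hy
  exact hsub t ht y hy

lemma Sys.marker {d : ℕ} {X : Set (ℤ → Fin d)} {μ : Measure (ℤ → Fin d)} (h : Sys d X μ)
    {c : ℝ} {N : ℕ} (hE : Eps d X μ c N) {U : Set (ℤ → Fin d)} (hU : MeasurableSet U)
    {l τ : ℕ} (hl : l + τ ≤ N)
    (hdet : ∀ x y : ℤ → Fin d, (∀ k : ℕ, k < l → x k = y k) → x ∈ U → y ∈ U)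
    {w z : ℤ → Fin d} (hw : w ∈ X) (hwU : ∀ t < τ, (shiftS d)^[t] w ∈ U)
    (hz : z ∈ X) (hzU : z ∉ U) :
    τ * (c / N) ≤ μ.real U := by
  have := h.prob
  -- the transfer along equal blocks
  have tr : ∀ x y : ℤ → Fin d, (∀ k : Fin N, x ((k : ℕ) : ℤ) = y ((k : ℕ) : ℤ)) → ∀ t ≤ τ,
      (shiftS d)^[t] x ∈ U → (shiftS d)^[t] y ∈ U := by
    intro x y hxy t ht
    apply hdet
    intro k hk
    rw [iter_apply, iter_apply]
    have := hxy ⟨k + t, by omega⟩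
    simpa using this
  obtain ⟨m, hm⟩ := h.hit hw hz l
  have hmU : shiftZ d m w ∉ U := fun hh => hzU (hdet _ _ hm hh)
  have fin : ∀ x ∈ X, ∀ a : ℕ,
      (∀ t < τ, ∀ y, (shiftS d)^[t] y ∈ cyl X (fun k : Fin N => x ((k : ℕ) : ℤ)) →
        (shiftS d)^[a] y ∈ U) →
      (∀ s t, s < t → t < τ → ∀ y, 
        (shiftS d)^[s] y ∈ cyl X (fun k : Fin N => x ((k : ℕ) : ℤ)) →
        (shiftS d)^[t] y ∈ cyl X (fun k : Fin N => x ((k : ℕ) : ℤ)) → False) →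
      τ * (c / N) ≤ μ.real U := by
    intro x hx a h1 h2
    have h3 := hE (fun k : Fin N => x ((k : ℕ) : ℤ)) ⟨x, hx, fun _ => rfl⟩
    have h4 := marker_aux h.mp (meas_cyl h.closed _) hU h1 h2
    refine le_trans ?_ h4
    exact mul_le_mul_of_nonneg_left h3.le (Nat.cast_nonneg _)
  by_cases hpos : 0 ≤ m
  · -- exit to the right
    have hex : ∃ j : ℕ, (shiftS d)^[j] w ∉ U := by
      lift m to ℕ using hpos
      exact ⟨m, by rwa [← shiftZ_nat]⟩
    classical
    have hj := Nat.find_spec hex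
    have hmin := fun i => Nat.find_min (m := i) hex
    set j := Nat.find hex with hjdef
    have hjτ : τ ≤ j := by
      by_contra hlt
      exact hj (hwU j (by omega))
    have hxin : ∀ t < τ, (shiftS d)^[t] ((shiftS d)^[j - τ] w) ∈ U := by
      intro t ht
      rw [← Function.iterate_add_apply]
      have := hmin (t + (j - τ)) (by omega)
      simpa using this
    have hxout : (shiftS d)^[τ] ((shiftS d)^[j - τ] w) ∉ U := by
      rw [← Function.iterate_add_apply]
      have : τ + (j - τ) = j := by omega
      rwa [this]
    set x := (shiftS d)^[j - τ] w with hx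
    refine fin x (h.iter hw _) (τ - 1) ?_ ?_
    · intro t ht y hy
      have := tr x _ (fun k => (hy.2 k).symm) (τ - 1 - t) (by omega) (hxin _ (by omega))
      rw [← Function.iterate_add_apply] at this
      have h5 : τ - 1 - t + t = τ - 1 := by omega
      rwa [h5] at this
    · intro s t hst ht y hs hty
      apply hxout
      have h6 := tr x _ (fun k => (hty.2 k).symm) (τ - (t - s)) (by omega) (hxin _ (by omega))
      refine tr _ x (fun k => (hs.2 k)) τ le_rfl ?_
      rw [← Function.iterate_add_apply] at h6 ⊢
      have h5 : τ - (t - s) + t = τ + s := by omega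
      rwa [h5] at h6
  · -- exit to the left
    have hex : ∃ j : ℕ, shiftZ d (-(j : ℤ)) w ∉ U := by
      refine ⟨m.natAbs, ?_⟩
      have : -((m.natAbs : ℕ) : ℤ) = m := by omega
      rwa [this]
    classical
    have hj := Nat.find_spec hex
    have hmin := fun i => Nat.find_min (m := i) hex
    set j := Nat.find hex with hjdef
    have hxin : ∀ t, 1 ≤ t → t ≤ τ → 1 ≤ j → (shiftS d)^[t] (shiftZ d (-(j : ℤ)) w) ∈ U := by
      intro t ht1 ht hj1
      rw [iter_shiftZ]
      by_cases htj : t ≤ j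
      · have := hmin (j - t) (by omega)
        have h7 : -((j : ℤ)) + t = -((j - t : ℕ) : ℤ) := by omega
        rw [h7]
        simpa using this
      · have h7 : -((j : ℤ)) + t = ((t - j : ℕ) : ℤ) := by omega
        rw [h7, shiftZ_nat]
        exact hwU _ (by omega)
    rcases Nat.eq_zero_or_pos τ with h0 | h0
    · subst h0
      simp
    have hj1 : 1 ≤ j := by
      by_contra hlt
      have h8 : j = 0 := by omega
      rw [h8] at hj
      apply hj
      have := hwU 0 h0
      rw [← shiftZ_nat] at this
      simpa using this
    set x := shiftZ d (-(j : ℤ)) w with hx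
    refine fin x (h.inv _ hw _) τ ?_ ?_
    · intro t ht y hy
      have := tr x _ (fun k => (hy.2 k).symm) (τ - t) (by omega)
        (hxin _ (by omega) (by omega) hj1)
      rw [← Function.iterate_add_apply] at this
      have h5 : τ - t + t = τ := by omega
      rwa [h5] at this
    · intro s t hst ht y hs hty
      apply hj
      have h6 := tr x _ (fun k => (hs.2 k).symm) (t - s) (by omega)
        (hxin _ (by omega) (by omega) hj1)
      refine tr _ x (fun k => (hty.2 k)) 0 (by omega) ?_
      rw [← Function.iterate_add_apply] at h6
      have h5 : t - s + s = t := by omega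
      rwa [h5] at h6

/-- discrete intermediate value theorem on `ℕ` -/
lemma ivt_nat (g : ℕ → ℝ) (ε y : ℝ) (hg : ∀ k, |g (k + 1) - g k| ≤ ε) (T : ℕ)
    (h : (g 0 ≤ y ∧ y ≤ g T) ∨ (g T ≤ y ∧ y ≤ g 0)) : ∃ k, |g k - y| ≤ ε := by
  induction T with
  | zero =>
    refine ⟨0, ?_⟩
    have h0 : g 0 = y := by
      rcases h with h | h <;> linarith [h.1, h.2]
    rw [h0]
    simpa using (abs_nonneg _).trans (hg 0)
  | succ T ih =>
    have hT := abs_le.1 (hg T)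
    by_cases hc : (g 0 ≤ y ∧ y ≤ g T) ∨ (g T ≤ y ∧ y ≤ g 0)
    · exact ih hc
    · refine ⟨T, abs_le.2 ?_⟩
      push Not at hc
      rcases h with h | h
      · have := hc.1 h.1
        constructor <;> linarith [h.2]
      · have h9 : y < g T := by
          by_contra hh
          exact absurd (hc.2 (not_lt.1 hh)) (not_lt.2 h.2)
        constructor <;> linarith [h.1]

lemma ivt_int (g : ℤ → ℝ) (ε y : ℝ) (hg : ∀ k, |g (k + 1) - g k| ≤ ε) (T : ℤ)
    (h : g T ≤ y ∧ y ≤ g 0) : ∃ k, |g k - y| ≤ ε := by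
  rcases le_total 0 T with hT | hT
  · lift T to ℕ using hT
    obtain ⟨k, hk⟩ := ivt_nat (fun k => g k) ε y (fun k => by simpa using hg k) T
      (Or.inr (by simpa using h))
    exact ⟨k, hk⟩
  · obtain ⟨S, hS⟩ : ∃ S : ℕ, T = -(S : ℤ) := ⟨T.natAbs, by omega⟩
    subst hS
    obtain ⟨k, hk⟩ := ivt_nat (fun k => g (-(k : ℤ))) ε y (fun k => by
      have := hg (-((k + 1 : ℕ) : ℤ))
      rw [abs_sub_comm]
      have h1 : -((k + 1 : ℕ) : ℤ) + 1 = -(k : ℤ) := by push_cast; ring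
      rw [h1] at this
      exact this) S
      (Or.inr (by simpa using h))
    exact ⟨_, hk⟩

/-- Birkhoff sums. -/
def F {d : ℕ} (f : (ℤ → Fin d) → ℝ) (m : ℕ) (w : ℤ → Fin d) : ℝ :=
  ∑ j ∈ Finset.range m, f ((shiftS d)^[j] w)

/-- admissible observables: measurable, with values in `[0,1]`, depending on `n0` coordinates -/
structure Obs (d : ℕ) (f : (ℤ → Fin d) → ℝ) (n0 : ℕ) : Prop where
  meas : Measurable f
  nonneg : ∀ w, 0 ≤ f w
  le_one : ∀ w, f w ≤ 1
  loc : ∀ x y : ℤ → Fin d, (∀ k : ℕ, k < n0 → x k = y k) → f x = f y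

lemma F_add {d : ℕ} (f : (ℤ → Fin d) → ℝ) (a b : ℕ) (w : ℤ → Fin d) :
    F f (a + b) w = F f a w + F f b ((shiftS d)^[a] w) := by
  unfold F
  rw [Finset.sum_range_add]
  congr 1
  refine Finset.sum_congr rfl fun j _ => ?_
  rw [← Function.iterate_add_apply, add_comm]

lemma F_slide {d : ℕ} (f : (ℤ → Fin d) → ℝ) (m t : ℕ) (w : ℤ → Fin d) :
    F f m ((shiftS d)^[t] w) - F f m w = F f t ((shiftS d)^[m] w) - F f t w := by
  have h1 := F_add f m t w
  have h2 := F_add f t m w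
  rw [add_comm t m] at h2
  linarith

lemma F_mul {d : ℕ} (f : (ℤ → Fin d) → ℝ) (q e : ℕ) (w : ℤ → Fin d) :
    F f (q * e) w = ∑ s ∈ Finset.range q, F f e ((shiftS d)^[s * e] w) := by
  induction q with
  | zero => simp [F]
  | succ q ih => rw [Nat.succ_mul, F_add, ih, Finset.sum_range_succ]

lemma F_loc {d : ℕ} {f : (ℤ → Fin d) → ℝ} {n0 : ℕ} (hf : Obs d f n0) (m : ℕ)
    (x y : ℤ → Fin d) (hxy : ∀ k : ℕ, k < m + n0 → x k = y k) : F f m x = F f m y := by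
  refine Finset.sum_congr rfl fun j hj => hf.loc _ _ fun k hk => ?_
  rw [iter_apply, iter_apply]
  have := hxy (k + j) (by have := Finset.mem_range.1 hj; omega)
  simpa using this

lemma F_meas {d : ℕ} {f : (ℤ → Fin d) → ℝ} {n0 : ℕ} (hf : Obs d f n0) 
    (hS : Measurable (shiftS d)) (m : ℕ) : Measurable (F f m) := by
  unfold F
  exact Finset.measurable_fun_sum _ fun j _ => hf.meas.comp (hS.iterate j)

lemma F_nonneg {d : ℕ} {f : (ℤ → Fin d) → ℝ} {n0 : ℕ} (hf : Obs d f n0) (m : ℕ) (w) :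
    0 ≤ F f m w := Finset.sum_nonneg fun _ _ => hf.nonneg _

lemma F_le {d : ℕ} {f : (ℤ → Fin d) → ℝ} {n0 : ℕ} (hf : Obs d f n0) (m : ℕ) (w) :
    F f m w ≤ m := by
  have := Finset.sum_le_card_nsmul (Finset.range m) (fun j => f ((shiftS d)^[j] w)) 1
    (fun _ _ => hf.le_one _)
  simpa [F] using this

/-- bound for differences of Birkhoff sums of length `t` -/
def DB {d : ℕ} (X : Set (ℤ → Fin d)) (f : (ℤ → Fin d) → ℝ) (t : ℕ) (M : ℝ) : Prop :=
  ∀ w ∈ X, ∀ w' ∈ X, F f t w - F f t w' ≤ M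

lemma DB.abs {d : ℕ} {X : Set (ℤ → Fin d)} {f : (ℤ → Fin d) → ℝ} {t : ℕ} {M : ℝ}
    (h : DB X f t M) {w w' : ℤ → Fin d} (hw : w ∈ X) (hw' : w' ∈ X) :
    |F f t w - F f t w'| ≤ M := by
  rw [abs_sub_le_iff]
  exact ⟨h w hw w' hw', h w' hw' w hw⟩

/-- if sums of length `r` vary by at most `M` and the shorter ones by at most `M'` ... -/
lemma Sys.DB_div {d : ℕ} {X : Set (ℤ → Fin d)} {μ : Measure (ℤ → Fin d)} (h : Sys d X μ)
    {f : (ℤ → Fin d) → ℝ} {r q s : ℕ} {M M' : ℝ} (h1 : DB X f r M) (h2 : DB X f s M') :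
    DB X f (q * r + s) (q * M + M') := by
  intro w hw w' hw'
  rw [F_add, F_add, F_mul, F_mul]
  have h3 := h2 _ (h.iter hw (q * r)) _ (h.iter hw' (q * r))
  have h4 : ∑ i ∈ Finset.range q, (F f r ((shiftS d)^[i * r] w) - F f r ((shiftS d)^[i * r] w')) 
      ≤ ∑ i ∈ Finset.range q, M := 
    Finset.sum_le_sum fun i _ => h1 _ (h.iter hw _) _ (h.iter hw' _)
  rw [Finset.sum_sub_distrib] at h4
  simp only [Finset.sum_const, Finset.card_range, nsmul_eq_mul] at h4
  linarith

lemma Sys.DB_all {d : ℕ} {X : Set (ℤ → Fin d)} {μ : Measure (ℤ → Fin d)} (h : Sys d X μ)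
    {f : (ℤ → Fin d) → ℝ} {n0 : ℕ} {R : ℝ} (hn : 0 < n0) (hR : 0 < R)
    (h1 : ∀ t ≤ n0, DB X f t (n0 * R)) (t : ℕ) : DB X f t ((t + n0) * R) := by
  have h2 := h.DB_div (q := t / n0) (h1 n0 le_rfl) (h1 (t % n0) (Nat.mod_lt _ hn).le)
  have h3 : t / n0 * n0 + t % n0 = t := Nat.div_add_mod' t n0
  rw [h3] at h2
  intro w hw w' hw'
  refine (h2 w hw w' hw').trans ?_
  have h4 : ((t / n0 : ℕ) : ℝ) * n0 ≤ t := by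
    exact_mod_cast Nat.div_mul_le_self t n0
  nlinarith

/-- averages -/
noncomputable def A {d : ℕ} (f : (ℤ → Fin d) → ℝ) (m : ℕ) (w : ℤ → Fin d) : ℝ := F f m w / m

/-- energy -/
noncomputable def En {d : ℕ} (μ : Measure (ℤ → Fin d)) (f : (ℤ → Fin d) → ℝ) (θ : ℝ) (m : ℕ) : ℝ :=
  ∫ w, (A f m w - θ) ^ 2 ∂μ

lemma A_mul {d : ℕ} (f : (ℤ → Fin d) → ℝ) {q e : ℕ} (hq : 0 < q) (he : 0 < e) (w : ℤ → Fin d) :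
    q * A f (q * e) w = ∑ s ∈ Finset.range q, A f e ((shiftS d)^[s * e] w) := by
  unfold A
  rw [F_mul, ← Finset.sum_div]
  push_cast
  field_simp

lemma A_meas {d : ℕ} {f : (ℤ → Fin d) → ℝ} {n0 : ℕ} (hf : Obs d f n0) 
    (hS : Measurable (shiftS d)) (m : ℕ) : Measurable (A f m) := 
  (F_meas hf hS m).div_const _

lemma A_bd {d : ℕ} {f : (ℤ → Fin d) → ℝ} {n0 : ℕ} (hf : Obs d f n0) (m : ℕ) (w) :
    |A f m w| ≤ 1 := by
  unfold A
  rw [abs_of_nonneg (div_nonneg (F_nonneg hf m w) (Nat.cast_nonneg _))]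
  exact div_le_one_of_le₀ (F_le hf m w) (Nat.cast_nonneg _)

lemma sq_int {d : ℕ} {μ : Measure (ℤ → Fin d)} [IsProbabilityMeasure μ]
    {f : (ℤ → Fin d) → ℝ} {n0 : ℕ} (hf : Obs d f n0) 
    (hS : Measurable (shiftS d)) (m : ℕ) (θ : ℝ) : Integrable (fun w => (A f m w - θ) ^ 2) μ := by
  refine Integrable.of_bound (C := (1 + |θ|) ^ 2) ?_ (Eventually.of_forall fun w => ?_)
  · exact (((A_meas hf hS m).sub_const θ).pow_const 2).aestronglyMeasurable
  · rw [norm_pow, Real.norm_eq_abs]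
    have := A_bd hf m w
    have h2 := abs_sub (A f m w) θ
    gcongr
    linarith

/-- the energy drop -/
lemma Sys.drop {d : ℕ} {X : Set (ℤ → Fin d)} {μ : Measure (ℤ → Fin d)} (h : Sys d X μ)
    {f : (ℤ → Fin d) → ℝ} {n0 : ℕ} (hf : Obs d f n0) (θ : ℝ) {q e : ℕ} (hq : 0 < q) (he : 0 < e)
    {U : Set (ℤ → Fin d)} (hU : MeasurableSet U) (κ : ℝ)
    (hκ : ∀ w ∈ X, w ∈ U → ∃ s < q, κ ≤ (A f e ((shiftS d)^[s * e] w) - A f (q * e) w) ^ 2) :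
    En μ f θ (q * e) + κ / q * μ.real U ≤ En μ f θ e := by
  have := h.prob
  have hS := h.mp.measurable
  have hq' : (0 : ℝ) < q := by exact_mod_cast hq
  have hX : ∀ᵐ w ∂μ, w ∈ X := by
    rw [ae_iff]
    exact h.null
  have hi : ∀ s, Integrable (fun w => (A f e ((shiftS d)^[s * e] w) - θ) ^ 2) μ := fun s =>
    (h.mp.iterate (s * e)).integrable_comp_of_integrable (sq_int hf hS e θ)
  have hE : ∀ s, ∫ w, (A f e ((shiftS d)^[s * e] w) - θ) ^ 2 ∂μ = En μ f θ e := by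
    intro s
    have h1 := integral_map (μ := μ) (h.mp.iterate (s * e)).measurable.aemeasurable
      (f := fun w => (A f e w - θ) ^ 2) (by
        exact (((A_meas hf hS e).sub_const θ).pow_const 2).aestronglyMeasurable)
    rw [(h.mp.iterate (s * e)).map_eq] at h1
    exact h1.symm
  have hsum : ∫ w, ∑ s ∈ Finset.range q, (A f e ((shiftS d)^[s * e] w) - θ) ^ 2 ∂μ =
      q * En μ f θ e := by
    rw [integral_finsetSum _ fun s _ => hi s, Finset.sum_congr rfl fun s _ => hE s]
    simp
  have hind : ∫ w, U.indicator (fun _ => κ) w ∂μ = κ * μ.real U := by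
    rw [integral_indicator hU]
    simp [mul_comm]
  have hpt : ∀ᵐ w ∂μ, q * (A f (q * e) w - θ) ^ 2 + U.indicator (fun _ => κ) w ≤
      ∑ s ∈ Finset.range q, (A f e ((shiftS d)^[s * e] w) - θ) ^ 2 := by
    filter_upwards [hX] with w hw
    have hav := A_mul f hq he w
    set a := A f (q * e) w
    have hid : ∑ s ∈ Finset.range q, (A f e ((shiftS d)^[s * e] w) - θ) ^ 2 =
        q * (a - θ) ^ 2 + ∑ s ∈ Finset.range q, (A f e ((shiftS d)^[s * e] w) - a) ^ 2 := by
      have h3 : ∀ s ∈ Finset.range q, (A f e ((shiftS d)^[s * e] w) - θ) ^ 2 =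
          (A f e ((shiftS d)^[s * e] w) - a) ^ 2 + 
          (2 * (a - θ) * A f e ((shiftS d)^[s * e] w) + (θ ^ 2 - a ^ 2)) := by
        intro s _
        ring
      rw [Finset.sum_congr rfl h3, Finset.sum_add_distrib, Finset.sum_add_distrib,
        ← Finset.mul_sum, ← hav]
      simp
      ring
    rw [hid]
    gcongr
    have hnn : ∀ s ∈ Finset.range q, 0 ≤ (A f e ((shiftS d)^[s * e] w) - a) ^ 2 :=
      fun s _ => sq_nonneg _
    by_cases hwU : w ∈ U
    · rw [Set.indicator_of_mem hwU]
      obtain ⟨s, hs, hle⟩ := hκ w hw hwU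
      exact hle.trans (Finset.single_le_sum hnn (Finset.mem_range.2 hs))
    · rw [Set.indicator_of_notMem hwU]
      exact Finset.sum_nonneg hnn
  have hint1 : Integrable (fun w => q * (A f (q * e) w - θ) ^ 2) μ :=
    (sq_int hf hS (q * e) θ).const_mul _
  have hint2 : Integrable (fun w => U.indicator (fun _ => κ) w) μ :=
    (integrable_const κ).indicator hU
  have hfin := integral_mono_ae (hint1.add hint2) 
    (integrable_finsetSum _ fun s _ => hi s) hpt
  simp only [Pi.add_apply] at hfin
  rw [integral_add hint1 hint2, hind, hsum, integral_const_mul] at hfin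
  change q * En μ f θ (q * e) + _ ≤ _ at hfin
  rw [div_mul_eq_mul_div]
  have : κ * μ.real U / q ≤ En μ f θ e - En μ f θ (q * e) := by
    rw [div_le_iff₀ hq']
    linarith
  linarith

lemma Sys.mono {d : ℕ} {X : Set (ℤ → Fin d)} {μ : Measure (ℤ → Fin d)} (h : Sys d X μ)
    {f : (ℤ → Fin d) → ℝ} {n0 : ℕ} (hf : Obs d f n0) (θ : ℝ) {q e : ℕ} (hq : 0 < q) (he : 0 < e) :
    En μ f θ (q * e) ≤ En μ f θ e := by
  have := h.drop hf θ hq he MeasurableSet.empty 0 (by simp)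
  simpa using this

lemma Sys.A_slide {d : ℕ} {X : Set (ℤ → Fin d)} {μ : Measure (ℤ → Fin d)} (h : Sys d X μ)
    {f : (ℤ → Fin d) → ℝ} {n0 : ℕ} {R : ℝ} (hD : ∀ t, DB X f t ((t + n0) * R)) 
    {w : ℤ → Fin d} (hw : w ∈ X) (m t : ℕ) :
    |A f m ((shiftS d)^[t] w) - A f m w| ≤ (t + n0) * R / m := by
  unfold A
  rw [← sub_div, F_slide, abs_div, Nat.abs_cast]
  gcongr
  exact (hD t).abs (h.iter hw m) hw

lemma level_meas {d : ℕ} {f : (ℤ → Fin d) → ℝ} {n0 : ℕ} (hf : Obs d f n0) 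
    (hS : Measurable (shiftS d)) (m : ℕ) (y ρ : ℝ) : 
    MeasurableSet {w | |A f m w - y| < ρ} :=
  measurableSet_lt (((A_meas hf hS m).sub_const y).abs) measurable_const

lemma level_loc {d : ℕ} {f : (ℤ → Fin d) → ℝ} {n0 : ℕ} (hf : Obs d f n0) 
    (m : ℕ) (y ρ : ℝ) (x x' : ℤ → Fin d) (hx : ∀ k : ℕ, k < m + n0 → x k = x' k) :
    x ∈ {w | |A f m w - y| < ρ} → x' ∈ {w | |A f m w - y| < ρ} := by
  intro h
  simp only [A, Set.mem_ofPred_eq] at h ⊢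
  rwa [← F_loc hf m x x' hx]

/-- Some level is not attained on a long interval. -/
lemma Sys.claim2 {d : ℕ} {X : Set (ℤ → Fin d)} {μ : Measure (ℤ → Fin d)} (h : Sys d X μ)
    {f : (ℤ → Fin d) → ℝ} {n0 : ℕ} (hf : Obs d f n0) {c : ℝ} {N m P : ℕ} (hE : Eps d X μ c N)
    (hm : 0 < m) (hN : 2 * m + n0 ≤ N) (hc : (N : ℝ) < P * m * c) {δ α : ℝ} (hδ : 0 < δ)
    {u v : ℤ → Fin d} (hu : u ∈ X) (hv : v ∈ X) (huv : δ < A f (2 * m) u - A f (2 * m) v) :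
    ∃ p < P, ∀ w ∈ X, ∃ t < m, δ / 2 ≤ |A f m ((shiftS d)^[t] w) - (α + (p + 1 / 2) * δ)| := by
  have := h.prob
  have hS := h.mp.measurable
  have hN0 : (0 : ℝ) < N := by
    have : 0 < N := by omega
    exact_mod_cast this
  by_contra hcon
  push Not at hcon
  set I : ℕ → Set (ℤ → Fin d) := fun p => {w | |A f m w - (α + (p + 1 / 2) * δ)| < δ / 2} with hI
  have hIm : ∀ p, MeasurableSet (I p) := fun p => level_meas hf hS m _ _
  have h1 : ∀ p < P, m * (c / N) ≤ μ.real (I p) := by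
    intro p hp
    obtain ⟨w, hw, hwt⟩ := hcon p hp
    have hz : ∃ z ∈ X, z ∉ I p := by
      by_contra hz
      push Not at hz
      have hu1 := A_mul f (q := 2) two_pos hm u
      have hv1 := A_mul f (q := 2) two_pos hm v
      simp only [Finset.sum_range_succ, Finset.sum_range_zero, zero_add] at hu1 hv1
      have a1 := hz _ (h.iter hu (0 * m))
      have a2 := hz _ (h.iter hu (1 * m))
      have a3 := hz _ (h.iter hv (0 * m))
      have a4 := hz _ (h.iter hv (1 * m))
      simp only [hI, Set.mem_ofPred_eq, abs_lt] at a1 a2 a3 a4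
      push_cast at hu1 hv1
      linarith [a1.1, a1.2, a2.1, a2.2, a3.1, a3.2, a4.1, a4.2]
    obtain ⟨z, hzX, hzI⟩ := hz
    exact h.marker hE (hIm p) (l := m + n0) (τ := m) (by omega)
      (fun x y hxy => level_loc hf m _ _ x y hxy) hw hwt hzX hzI
  have h2 : μ.real (⋃ p ∈ Finset.range P, I p) = ∑ p ∈ Finset.range P, μ.real (I p) := by
    refine measureReal_biUnion_finset ?_ (fun p _ => hIm p) (fun p _ => measure_ne_top _ _)
    intro p _ p' _ hpp
    refine Set.disjoint_left.2 fun w hw hw' => ?_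
    simp only [hI, Set.mem_ofPred_eq, abs_lt] at hw hw'
    rcases lt_or_gt_of_ne hpp with hlt | hlt
    · have : (p : ℝ) + 1 ≤ p' := by exact_mod_cast hlt
      nlinarith [hw.1, hw.2, hw'.1, hw'.2]
    · have : (p' : ℝ) + 1 ≤ p := by exact_mod_cast hlt
      nlinarith [hw.1, hw.2, hw'.1, hw'.2]
  have h3 : ∑ p ∈ Finset.range P, (m * (c / N) : ℝ) ≤ ∑ p ∈ Finset.range P, μ.real (I p) :=
    Finset.sum_le_sum fun p hp => h1 p (Finset.mem_range.1 hp)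
  rw [← h2] at h3
  simp only [Finset.sum_const, Finset.card_range, nsmul_eq_mul] at h3
  have h4 := h3.trans measureReal_le_one
  have h5 : (P : ℝ) * (m * (c / N)) = P * m * c / N := by ring
  rw [h5, div_le_one hN0] at h4
  linarith

/-- every level is attained with positive frequency -/
lemma Sys.claim1 {d : ℕ} {X : Set (ℤ → Fin d)} {μ : Measure (ℤ → Fin d)} (h : Sys d X μ)
    {f : (ℤ → Fin d) → ℝ} {n0 : ℕ} (hf : Obs d f n0) {R : ℝ} (hR : 0 < R)
    (hD : ∀ t, DB X f t ((t + n0) * R)) 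
    {c : ℝ} {N r τ : ℕ} (hE : Eps d X μ c N) (hn0 : 0 < n0)
    (hr : 0 < r) (hN : r + n0 + τ ≤ N) (hτ : 0 < τ) {δ y : ℝ} (hδ : 0 < δ)
    (hs : (τ + n0) * R / r ≤ δ / 8)
    {u v : ℤ → Fin d} (hu : u ∈ X) (hv : v ∈ X) (hyv : A f r v + δ / 2 ≤ y) 
    (hyu : y + δ / 2 ≤ A f r u) :
    τ * (c / N) ≤ μ.real {w | |A f r w - y| < δ / 3} := by
  have hS := h.mp.measurable
  obtain ⟨T, hT⟩ := h.hit hu hv (r + n0)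
  have hTA : A f r (shiftZ d T u) = A f r v := by
    unfold A
    rw [F_loc hf r _ _ hT]
  have hrR : (0 : ℝ) < r := by exact_mod_cast hr
  obtain ⟨k, hk⟩ := ivt_int (fun k => A f r (shiftZ d k u)) (δ / 8) y (by
    intro k
    have h1 := h.A_slide hD (h.inv u hu k) r 1
    rw [iter_shiftZ] at h1
    refine h1.trans (le_trans ?_ hs)
    gcongr
    exact_mod_cast hτ) T (by
    have h0 : shiftZ d 0 u = u := by
      funext k
      simp [shiftZ]
    simp only [hTA, h0]
    constructor <;> linarith)
  have hwX := h.inv u hu k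
  refine h.marker hE (level_meas hf hS r _ _) (l := r + n0) hN
    (fun x y hxy => level_loc hf r _ _ x y hxy) hwX ?_ hv ?_
  · intro t ht
    have h1 := h.A_slide hD hwX r t
    have h2 : ((t : ℝ) + n0) * R / r ≤ δ / 8 := by
      refine le_trans ?_ hs
      gcongr
    simp only [Set.mem_ofPred_eq]
    have h3 := abs_le.1 (h1.trans h2)
    have h4 := abs_le.1 hk
    rw [abs_lt]
    constructor <;> linarith [h3.1, h3.2, h4.1, h4.2]
  · simp only [Set.mem_ofPred_eq, not_lt]
    rw [abs_of_nonpos (by linarith)]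
    linarith

lemma Sys.scale {d : ℕ} {X : Set (ℤ → Fin d)} {μ : Measure (ℤ → Fin d)} (h : Sys d X μ)
    {f : (ℤ → Fin d) → ℝ} {n0 : ℕ} (hf : Obs d f n0) {R : ℝ} (hR : 0 < R)
    (hD : ∀ t, DB X f t ((t + n0) * R)) (θ : ℝ)
    {c : ℝ} (hc : 0 < c) {N e P : ℕ} (hE : Eps d X μ c N) (hn0 : 0 < n0) (hne : n0 ≤ e)
    (hP : 2 ≤ P) (hPc : 16 < P * c) (hN1 : 4 * (64 * P * e) ≤ N) (hN2 : N ≤ 512 * P * e)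
    {u v : ℤ → Fin d} (hu : u ∈ X) (hv : v ∈ X) (huv : R / 2 ≤ A f (64 * P * e) u - A f (64 * P * e) v) :
    En μ f θ (64 * P * e) + (R / (48 * P)) ^ 2 / (64 * P) * (c / (256 * P)) ≤ En μ f θ e := by
  have he : 0 < e := by omega
  have heR : (0 : ℝ) < e := by exact_mod_cast he
  have hPR : (2 : ℝ) ≤ P := by exact_mod_cast hP
  have hneR : (n0 : ℝ) ≤ e := by exact_mod_cast hne
  have hPe : e * 2 ≤ P * e := by nlinarith
  have hN2R : (N : ℝ) ≤ 512 * P * e := by exact_mod_cast hN2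
  have hNpos : (0 : ℝ) < N := by
    have : 0 < N := by nlinarith
    exact_mod_cast this
  set δ : ℝ := R / (2 * P) with hδ
  have hδ0 : 0 < δ := by positivity
  have hδP : P * δ = R / 2 := by rw [hδ]; field_simp
  have hrm : 64 * P * e = 2 * (32 * P * e) := by ring
  obtain ⟨p, hp, hlev⟩ := h.claim2 hf (m := 32 * P * e) (P := P) hE (by nlinarith) 
    (by nlinarith) (by
      push_cast
      have : 0 < (P : ℝ) * e := by positivity
      nlinarith) hδ0 (α := A f (64 * P * e) v) hu hv (by
      rw [← hrm]
      nlinarith)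
  have hpP : (p : ℝ) + 1 ≤ P := by exact_mod_cast hp
  have hp0 : (0 : ℝ) ≤ p := Nat.cast_nonneg p
  set y : ℝ := A f (64 * P * e) v + (p + 1 / 2) * δ with hy
  have hU := h.claim1 hf hR hD (r := 64 * P * e) (τ := 2 * e) hE hn0 (by nlinarith) 
    (by nlinarith) (by omega) hδ0 (y := y) (by
      rw [hδ, div_div, div_le_div_iff₀ (by positivity) (by positivity)]
      push_cast
      have : 0 < (P : ℝ) * R := by positivity
      nlinarith) hu hv (by nlinarith) (by nlinarith)
  have hU2 : c / (256 * P) ≤ ((2 * e : ℕ) : ℝ) * (c / N) := by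
    rw [mul_div_assoc', div_le_div_iff₀ (by positivity) hNpos]
    push_cast
    nlinarith
  have hdrop := h.drop hf θ (q := 64 * P) (e := e) (by omega) he
    (level_meas hf h.mp.measurable (64 * P * e) y (δ / 3)) ((R / (48 * P)) ^ 2) (by
      intro w hw hwU
      simp only [Set.mem_ofPred_eq] at hwU
      obtain ⟨t, ht, htl⟩ := hlev w hw
      have hs : t / e < 32 * P := by
        rw [Nat.div_lt_iff_lt_mul he]
        exact ht
      have hts : (shiftS d)^[t] w = (shiftS d)^[t % e] ((shiftS d)^[t / e * e] w) := by
        rw [← Function.iterate_add_apply, add_comm, Nat.div_add_mod']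
      have hw1 := h.iter hw (t / e * e)
      have hsl := h.A_slide hD hw1 (32 * P * e) (t % e)
      rw [← hts] at hsl
      have hsl2 : ((t % e : ℕ) + n0 : ℝ) * R / (32 * P * e : ℕ) ≤ δ / 8 := by
        have h1 : ((t % e : ℕ) : ℝ) ≤ e := by exact_mod_cast (Nat.mod_lt t he).le
        rw [hδ, div_div, div_le_div_iff₀ (by positivity) (by positivity)]
        push_cast
        have h2 : 0 < (P : ℝ) * R := by positivity
        have h3 : 0 ≤ P * R * (2 * e - ((t % e : ℕ) + n0 : ℝ)) := by
          apply mul_nonneg h2.le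
          linarith
        nlinarith
      have hδκ : δ / 24 = R / (48 * P) := by
        rw [hδ]
        field_simp
        norm_num
      by_contra hno
      push Not at hno
      have hall : ∀ i ∈ Finset.range (32 * P), 
          |A f e ((shiftS d)^[i * e] ((shiftS d)^[t / e * e] w)) - A f (64 * P * e) w| ≤ δ / 24 := by
        intro i hi
        have h1 := hno (i + t / e) (by have := Finset.mem_range.1 hi; omega)
        rw [← hδκ] at h1
        rw [← Function.iterate_add_apply, ← add_mul]
        exact (abs_lt_of_sq_lt_sq h1 (by positivity)).le
      have hav := A_mul f (q := 32 * P) (by omega) he ((shiftS d)^[t / e * e] w)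
      have hsum : |∑ i ∈ Finset.range (32 * P), 
          (A f e ((shiftS d)^[i * e] ((shiftS d)^[t / e * e] w)) - A f (64 * P * e) w)| ≤
          ∑ i ∈ Finset.range (32 * P), δ / 24 :=
        (Finset.abs_sum_le_sum_abs _ _).trans (Finset.sum_le_sum hall)
      rw [Finset.sum_sub_distrib, ← hav] at hsum
      simp only [Finset.sum_const, Finset.card_range, nsmul_eq_mul] at hsum
      rw [← mul_sub, abs_mul, Nat.abs_cast] at hsum
      have hsum2 := le_of_mul_le_mul_left hsum (by push_cast; positivity)
      have b1 := abs_le.1 hsum2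
      have b2 := abs_le.1 (hsl.trans hsl2)
      have b3 := abs_lt.1 hwU
      have b4 : |A f (32 * P * e) ((shiftS d)^[t] w) - y| < δ / 2 := by
        rw [abs_lt]
        constructor <;> linarith [b1.1, b1.2, b2.1, b2.2, b3.1, b3.2]
      linarith)
  refine le_trans ?_ hdrop
  push_cast
  gcongr
  exact hU2.trans hU

lemma Obs.weaken {d : ℕ} {f : (ℤ → Fin d) → ℝ} {n0 n1 : ℕ} (hf : Obs d f n0) (h : n0 ≤ n1) :
    Obs d f n1 :=
  ⟨hf.meas, hf.nonneg, hf.le_one, fun x y hxy => hf.loc x y fun k hk => hxy k (by omega)⟩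

/-- the energy drop constant -/
noncomputable def eta (c : ℝ) (P : ℕ) : ℝ := (1 / (48 * P)) ^ 2 / (64 * P) * (c / (256 * P))

lemma Sys.contract {d : ℕ} {X : Set (ℤ → Fin d)} {μ : Measure (ℤ → Fin d)} (h : Sys d X μ)
    {f : (ℤ → Fin d) → ℝ} {R : ℝ} (hR : 0 < R) {c : ℝ} (hc : 0 < c) {P K : ℕ} 
    (hP : 2 ≤ P) (hPc : 16 < P * c) (hK : 4 < K * eta c P) (N : ℕ → ℕ) (hf : Obs d f (N 0))
    (hE : ∀ k, Eps d X μ c (N k)) (hN0 : 0 < N 0) (hN : ∀ k, 256 * P * N k ≤ N (k + 1))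
    (h0 : ∀ t ≤ N 0, DB X f t (N 0 * R)) : 
    ∀ t ≤ N K, DB X f t (7 / 8 * (N K * R)) := by
  by_contra hcon
  unfold DB at hcon
  push Not at hcon
  obtain ⟨T, hT, w1, hw1, w2, hw2, hlt⟩ := hcon
  have hD := h.DB_all hN0 hR h0
  have hmono : Monotone N := by
    refine monotone_nat_of_le_succ fun k => ?_
    have := hN k
    nlinarith
  have hK1 : 1 ≤ K := by
    rcases Nat.eq_zero_or_pos K with hK0 | hK0
    · subst hK0
      simp at hK
      linarith
    · exact hK0
  have h8 : 8 * N 0 ≤ N K := by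
    have h1 := hmono hK1
    have h2 := hN 0
    simp only [zero_add] at h2
    nlinarith
  have h8R : 8 * (N 0 : ℝ) ≤ N K := by exact_mod_cast h8
  have hTR : (T : ℝ) ≤ N K := by exact_mod_cast hT
  -- variation stays large at all intermediate lengths
  have hvar : ∀ r : ℕ, 0 < r → 4 * r ≤ N K → ∃ u ∈ X, ∃ v ∈ X, R / 2 ≤ A f r u - A f r v := by
    intro r hr hrK
    by_contra hno
    push Not at hno
    have hrR : (0 : ℝ) < r := by exact_mod_cast hr
    have hrKR : 4 * (r : ℝ) ≤ N K := by exact_mod_cast hrK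
    have hDr : DB X f r (r * (R / 2)) := by
      intro u hu v hv
      have h1 := hno u hu v hv
      unfold A at h1
      rw [← sub_div, div_lt_iff₀ hrR] at h1
      linarith
    have h2 := h.DB_div (q := T / r) hDr (hD (T % r))
    rw [Nat.div_add_mod'] at h2
    have h3 := h2 w1 hw1 w2 hw2
    have h4 : ((T / r : ℕ) : ℝ) * r ≤ T := by exact_mod_cast Nat.div_mul_le_self T r
    have h5 : ((T % r : ℕ) : ℝ) ≤ r := by exact_mod_cast (Nat.mod_lt T hr).le
    have h6 : ((T / r : ℕ) : ℝ) * (r * (R / 2)) ≤ N K * (R / 2) := by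
      rw [← mul_assoc]
      gcongr
      linarith
    have h7 : (((T % r : ℕ) : ℝ) + N 0) * R ≤ (N K / 4 + N K / 8) * R := by
      gcongr <;> linarith
    linarith
  set θ := A f (N 0) w1 with hθ
  have hind : ∀ k ≤ K, ∃ r, N 0 ≤ r ∧ r ≤ N k ∧ 
      En μ f θ r ≤ 4 * R ^ 2 - k * (eta c P * R ^ 2) := by
    intro k
    induction k with
    | zero =>
      intro _
      refine ⟨N 0, le_rfl, le_rfl, ?_⟩
      have := h.prob
      have hX : ∀ᵐ w ∂μ, w ∈ X := by
        rw [ae_iff]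
        exact h.null
      have h1 : En μ f θ (N 0) ≤ ∫ _, 4 * R ^ 2 ∂μ := by
        refine integral_mono_ae (sq_int hf h.mp.measurable _ _) (integrable_const _) ?_
        filter_upwards [hX] with w hw
        have h2 := (hD (N 0)).abs hw hw1
        have hN0R : (0 : ℝ) < N 0 := by exact_mod_cast hN0
        have h3 : |A f (N 0) w - θ| ≤ 2 * R := by
          rw [hθ]
          unfold A
          rw [← sub_div, abs_div, Nat.abs_cast, div_le_iff₀ hN0R]
          linarith
        have h4 := sq_le_sq' (abs_le.1 h3).1 (abs_le.1 h3).2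
        linarith
      simpa using h1
    | succ k ih =>
      intro hk
      obtain ⟨r, hr0, hrk, hEr⟩ := ih (by omega)
      have hrpos : 0 < r := by omega
      have hPr : 0 < 256 * P * r := by positivity
      set q := N (k + 1) / (256 * P * r) with hq
      have hq1 : 1 ≤ q := by
        rw [hq, Nat.one_le_div_iff hPr]
        exact le_trans (Nat.mul_le_mul_left _ hrk) (hN k)
      have hqu : q * (256 * P * r) ≤ N (k + 1) := Nat.div_mul_le_self _ _
      have hql : N (k + 1) < (q + 1) * (256 * P * r) := by
        rw [mul_comm]
        exact Nat.lt_mul_div_succ _ hPr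
      have hqe : r ≤ q * r := Nat.le_mul_of_pos_left _ hq1
      have hNk : N (k + 1) ≤ N K := hmono hk
      have hle : 4 * (64 * P * (q * r)) ≤ N (k + 1) := by
        refine le_trans (le_of_eq ?_) hqu
        ring
      obtain ⟨u, hu, v, hv, huv⟩ := hvar (64 * P * (q * r)) (by positivity) (hle.trans hNk)
      have hs := h.scale hf hR hD θ hc (hE (k + 1)) hN0 (e := q * r) (by omega) hP hPc hle (by
        refine hql.le.trans ?_
        have : q + 1 ≤ 2 * q := by omega
        calc (q + 1) * (256 * P * r) ≤ (2 * q) * (256 * P * r) := Nat.mul_le_mul_right _ this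
          _ = 512 * P * (q * r) := by ring) hu hv huv
      refine ⟨64 * P * (q * r), ?_, by omega, ?_⟩
      · refine le_trans hr0 (le_trans hqe ?_)
        exact Nat.le_mul_of_pos_left _ (by positivity)
      · have hm := h.mono hf θ (q := q) (e := r) hq1 hrpos
        have heq : (R / (48 * P)) ^ 2 / (64 * P) * (c / (256 * P)) = eta c P * R ^ 2 := by
          unfold eta
          ring
        rw [heq] at hs
        push_cast
        linarith
  obtain ⟨r, -, -, hr⟩ := hind K le_rfl
  have hnn : 0 ≤ En μ f θ r := integral_nonneg fun w => sq_nonneg _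
  have : 0 < R ^ 2 := by positivity
  nlinarith

lemma obs_blockInd {d n : ℕ} (b : Fin n → Fin d) : Obs d (blockInd b) n := by
  refine ⟨?_, ?_, ?_, ?_⟩
  · unfold blockInd
    refine Measurable.ite ?_ measurable_const measurable_const
    have : {w : ℤ → Fin d | ∀ k : Fin n, w ((k : ℕ) : ℤ) = b k} = 
        ⋂ k : Fin n, {w : ℤ → Fin d | w ((k : ℕ) : ℤ) = b k} := by
      ext w
      simp
    rw [this]
    refine MeasurableSet.iInter fun k => ?_
    exact (measurable_pi_apply (X := fun _ : ℤ => Fin d) ((k : ℕ) : ℤ))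
      (measurableSet_singleton (b k))
  · intro w
    unfold blockInd
    split_ifs <;> norm_num
  · intro w
    unfold blockInd
    split_ifs <;> norm_num
  · intro x y hxy
    unfold blockInd
    have : (∀ k : Fin n, x ((k : ℕ) : ℤ) = b k) ↔ (∀ k : Fin n, y ((k : ℕ) : ℤ) = b k) := by
      refine forall_congr' fun k => ?_
      rw [hxy k k.2]
    simp only [this]

end Bosh

theorem stmt2 : ∀ c : ℝ, 0 < c → ∃ C₁ C₂ : ℝ, 0 < C₁ ∧ 0 < C₂ ∧
    ∀ (d : ℕ), 1 ≤ d →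
    ∀ (X : Set (ℤ → Fin d)), X.Nonempty → IsClosed X →
    (∀ w ∈ X, ∀ m : ℤ, shiftZ d m w ∈ X) →
    (∀ w ∈ X, X ⊆ closure {v | ∃ m : ℤ, v = shiftZ d m w}) →
    ∀ (μ : Measure (ℤ → Fin d)), IsProbabilityMeasure μ → μ Xᶜ = 0 →
    MeasurePreserving (shiftS d) μ μ →
    ∀ (n : ℕ → ℕ), (∀ i, 1 ≤ i → 0 < n i) → (∀ i, 2 ≤ i → 10 * n (i - 1) < n i) →
    (∀ i, 1 ≤ i → ∀ b : Fin (n i) → Fin d, (cyl X b).Nonempty →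
      c / (n i : ℝ) < (μ (cyl X b)).toReal) →
    ∀ i, 1 ≤ i → ∀ L : ℕ, ∀ b : Fin (n i) → Fin d, (cyl X b).Nonempty →
    ∀ w ∈ X, ∀ w' ∈ X,
      (1 / (n (i + L) : ℝ)) *
          |∑ j ∈ Finset.Icc 1 (n (i + L)),
            (blockInd b ((shiftS d)^[j] w) - blockInd b ((shiftS d)^[j] w'))| <
        C₁ * Real.exp (-C₂ * L) := by
  intro c hc
  obtain ⟨P, hP, hPc⟩ : ∃ P : ℕ, 2 ≤ P ∧ 16 < P * c := by
    obtain ⟨P, hP⟩ := exists_nat_gt (16 / c)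
    refine ⟨P + 2, by omega, ?_⟩
    rw [div_lt_iff₀ hc] at hP
    push_cast
    linarith
  have hη : 0 < Bosh.eta c P := by
    have : (2 : ℝ) ≤ P := by exact_mod_cast hP
    unfold Bosh.eta
    positivity
  obtain ⟨K, hK⟩ := exists_nat_gt (4 / Bosh.eta c P)
  rw [div_lt_iff₀ hη] at hK
  have hK0 : 0 < K := by
    rcases Nat.eq_zero_or_pos K with h | h
    · subst h
      simp at hK
      linarith
    · exact h
  obtain ⟨g, hg0, hg⟩ : ∃ g : ℕ, 0 < g ∧ 256 * P ≤ 10 ^ g :=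
    ⟨256 * P, by omega, (Nat.lt_pow_self (by norm_num)).le⟩
  set H := g * K with hH
  have hH0 : 0 < H := Nat.mul_pos hg0 hK0
  have hH0R : (0 : ℝ) < H := by exact_mod_cast hH0
  have hlog : 0 < Real.log (8 / 7) := Real.log_pos (by norm_num)
  refine ⟨3, Real.log (8 / 7) / H, by norm_num, by positivity, ?_⟩
  intro d _ X _ hXc hinv hdense μ hμ hnull hmp n hn hn10 hE i hi L b _ w hw w' hw'
  have h : Bosh.Sys d X μ := ⟨hinv, hdense, hμ, hnull, hmp, hXc⟩
  have hf := Bosh.obs_blockInd b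
  have hpow : ∀ j a, 1 ≤ a → 10 ^ j * n a ≤ n (a + j) := by
    intro j a ha
    induction j with
    | zero => simp
    | succ j ih =>
      have := hn10 (a + (j + 1)) (by omega)
      have h1 : a + (j + 1) - 1 = a + j := by omega
      rw [h1] at this
      rw [pow_succ]
      linarith
  have hle : ∀ j a, 1 ≤ a → n a ≤ n (a + j) := fun j a ha =>
    le_trans (Nat.le_mul_of_pos_left _ (by positivity)) (hpow j a ha)
  have hit : ∀ j, ∀ t ≤ n (i + H * j), 
      Bosh.DB X (blockInd b) t (n (i + H * j) * (7 / 8 : ℝ) ^ j) := by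
    intro j
    induction j with
    | zero =>
      intro t ht x _ y _
      have h1 := Bosh.F_le hf t x
      have h2 := Bosh.F_nonneg hf t y
      have h3 : (t : ℝ) ≤ n (i + H * 0) := by exact_mod_cast ht
      rw [pow_zero, mul_one]
      linarith
    | succ j ih =>
      have hc1 := h.contract (R := (7 / 8 : ℝ) ^ j) (by positivity) hc hP hPc hK
        (fun k => n (i + H * j + g * k)) (hf.weaken (by simpa using hle (H * j) i hi))
        (fun k => hE _ (by omega)) (hn _ (by omega)) (fun k => by
          have h1 := hpow g (i + H * j + g * k) (by omega)
          have h2 : i + H * j + g * (k + 1) = i + H * j + g * k + g := by ring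
          rw [h2]
          exact le_trans (Nat.mul_le_mul_right _ hg) h1)
        (by simpa using ih)
      have h3 : i + H * (j + 1) = i + H * j + g * K := by rw [hH]; ring
      rw [h3]
      intro t ht x hx y hy
      refine (hc1 t ht x hx y hy).trans (le_of_eq ?_)
      rw [pow_succ]
      ring
  set j := L / H with hj
  have hpos : 0 < n (i + H * j) := hn _ (by omega)
  have hall := h.DB_all hpos (by positivity) (hit j) (n (i + L))
  have hLj : H * j ≤ L := Nat.mul_div_le L H
  have hnle : n (i + H * j) ≤ n (i + L) := by
    have := hle (L - H * j) (i + H * j) (by omega)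
    have h1 : i + H * j + (L - H * j) = i + L := by omega
    rwa [h1] at this
  have hnleR : (n (i + H * j) : ℝ) ≤ n (i + L) := by exact_mod_cast hnle
  have hnpos : (0 : ℝ) < n (i + L) := by exact_mod_cast hn (i + L) (by omega)
  have hsumF : ∀ x : ℤ → Fin d, ∑ k ∈ Finset.Icc 1 (n (i + L)), blockInd b ((shiftS d)^[k] x) =
      Bosh.F (blockInd b) (n (i + L)) ((shiftS d)^[1] x) := by
    intro x
    unfold Bosh.F
    rw [← Finset.Ico_succ_right_eq_Icc, Finset.sum_Ico_eq_sum_range]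
    refine Finset.sum_congr (by simp) fun k _ => ?_
    rw [← Function.iterate_add_apply, add_comm]
  rw [Finset.sum_sub_distrib, hsumF, hsumF]
  have hab := hall.abs (h.iter hw 1) (h.iter hw' 1)
  have hb1 : (1 / (n (i + L) : ℝ)) * |Bosh.F (blockInd b) (n (i + L)) ((shiftS d)^[1] w) -
      Bosh.F (blockInd b) (n (i + L)) ((shiftS d)^[1] w')| ≤ 2 * (7 / 8 : ℝ) ^ j := by
    rw [one_div, inv_mul_le_iff₀ hnpos]
    refine hab.trans ?_
    have : (0 : ℝ) < (7 / 8) ^ j := by positivity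
    nlinarith
  refine lt_of_le_of_lt hb1 ?_
  have hexp : (7 / 8 : ℝ) ^ j ≤ 8 / 7 * Real.exp (-(Real.log (8 / 7) / H) * L) := by
    have h1 : (7 / 8 : ℝ) ^ j = Real.exp (-(Real.log (8 / 7)) * j) := by
      rw [mul_comm, Real.exp_nat_mul, Real.exp_neg, Real.exp_log (by norm_num)]
      norm_num
    have h2 : (8 / 7 : ℝ) = Real.exp (Real.log (8 / 7)) := (Real.exp_log (by norm_num)).symm
    rw [h1]
    conv_rhs => rw [h2, ← Real.exp_add]
    rw [Real.exp_le_exp, ← h2]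
    have h3 : (L : ℝ) / H ≤ j + 1 := by
      rw [div_le_iff₀ hH0R]
      have : L < (j + 1) * H := by
        rw [hj]
        rw [mul_comm]
        exact Nat.lt_mul_div_succ _ hH0
      exact_mod_cast this.le
    have h4 : -(Real.log (8 / 7) / H) * L = -(Real.log (8 / 7)) * (L / H) := by ring
    rw [h4]
    nlinarith
  have hep := Real.exp_pos (-(Real.log (8 / 7) / H) * L)
  linarith
end

section
/- Let g_i : [0,1] → [0,∞) be measurable functions such that there exist constants C₁, C₂ > 0 with: (1) g_i(x) ≤ C₂ for all i and all x; (2) Σ_{i=1}^∞ ∫ g_i dλ = ∞; (3) for every i and every N > i, Σ_{j=i+1}^{N} ( ∫ g_j g_i dλ − ∫ g_i dλ · ∫ g_j dλ ) ≤ C₁ · ∫ g_i dλ. Then for Lebesgue-almost every x ∈ [0,1], lim_{N→∞} (Σ_{i=1}^N g_i(x)) / (Σ_{i=1}^N ∫ g_i dλ) = 1. -/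
open MeasureTheory Filter Set

lemma aux_double (c : ℕ → ℕ → ℝ) (hs : ∀ i j, c i j = c j i) (N : ℕ) :
    ∑ i ∈ Finset.Icc 1 N, ∑ j ∈ Finset.Icc 1 N, c i j =
      ∑ i ∈ Finset.Icc 1 N, c i i +
        2 * ∑ i ∈ Finset.Icc 1 N, ∑ j ∈ Finset.Icc (i + 1) N, c i j := by
  induction N with
  | zero => simp
  | succ N ih =>
    have h1 : ∑ i ∈ Finset.Icc 1 N, ∑ j ∈ Finset.Icc (i + 1) (N + 1), c i j =
        ∑ i ∈ Finset.Icc 1 N, ∑ j ∈ Finset.Icc (i + 1) N, c i j +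
          ∑ i ∈ Finset.Icc 1 N, c i (N + 1) := by
      rw [← Finset.sum_add_distrib]
      refine Finset.sum_congr rfl fun i hi => ?_
      rw [Finset.mem_Icc] at hi
      rw [Finset.sum_Icc_succ_top (by omega)]
    have h2 : ∑ j ∈ Finset.Icc 1 N, c (N + 1) j = ∑ i ∈ Finset.Icc 1 N, c i (N + 1) :=
      Finset.sum_congr rfl fun i _ => hs _ _
    have h3 : ∀ f : ℕ → ℝ, ∑ i ∈ Finset.Icc 1 (N + 1), f i =
        ∑ i ∈ Finset.Icc 1 N, f i + f (N + 1) := fun f =>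
      Finset.sum_Icc_succ_top (by omega) f
    rw [h3 (fun i => ∑ j ∈ Finset.Icc (i + 1) (N + 1), c i j), h1,
      Finset.Icc_eq_empty (show ¬ (N + 1 + 1 ≤ N + 1) by omega), Finset.sum_empty]
    simp only [h3]
    rw [Finset.sum_add_distrib, ih, h2]
    ring

lemma aux_ae {α : Type*} [MeasurableSpace α] (μ : Measure α) (f : ℕ → α → ℝ)
    (hm : ∀ k, Measurable (f k)) (h0 : ∀ k x, 0 ≤ f k x) (hi : ∀ k, Integrable (f k) μ)
    (b : ℕ → ℝ) (hb : Summable b) (hfb : ∀ k, ∫ x, f k x ∂μ ≤ b k) :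
    ∀ᵐ x ∂μ, Tendsto (fun k => f k x) atTop (nhds 0) := by
  have hlt : ∫⁻ x, ∑' k, ENNReal.ofReal (f k x) ∂μ ≠ ⊤ := by
    rw [lintegral_tsum (fun k => (hm k).ennreal_ofReal.aemeasurable)]
    have : ∀ k, ∫⁻ x, ENNReal.ofReal (f k x) ∂μ ≤ ENNReal.ofReal (b k) := fun k => by
      rw [← ofReal_integral_eq_lintegral_ofReal (hi k) (Eventually.of_forall (h0 k))]
      exact ENNReal.ofReal_le_ofReal (hfb k)
    exact ne_top_of_le_ne_top hb.tsum_ofReal_ne_top (ENNReal.tsum_le_tsum this)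
  have hae := ae_lt_top (Measurable.tsum fun k => (hm k).ennreal_ofReal) hlt
  filter_upwards [hae] with x hx
  have := ENNReal.tendsto_atTop_zero_of_tsum_ne_top hx.ne
  have h2 := (ENNReal.tendsto_toReal (ENNReal.zero_ne_top)).comp this
  refine h2.congr fun k => ?_
  simp [ENNReal.toReal_ofReal (h0 k x)]

lemma aux_interp (S E : ℕ → ℝ) (hS : Monotone S) (hS0 : ∀ n, 0 ≤ S n)
    (hE : Monotone E) (hdiv : Tendsto E atTop atTop) (n : ℕ → ℕ)
    (hn1 : ∀ k : ℕ, (k : ℝ) ^ 2 ≤ E (n k))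
    (hn2 : ∀ k N : ℕ, (k : ℝ) ^ 2 ≤ E N → n k ≤ N)
    (hT : Tendsto (fun k : ℕ => S (n k) / (k : ℝ) ^ 2) atTop (nhds 1)) :
    Tendsto (fun N => S N / E N) atTop (nhds 1) := by
  have hk : Tendsto (fun N => ⌊Real.sqrt (E N)⌋₊) atTop atTop :=
    tendsto_nat_floor_atTop.comp (Real.tendsto_sqrt_atTop.comp hdiv)
  have hr : Tendsto (fun k : ℕ => (k : ℝ) / ((k : ℝ) + 1)) atTop (nhds 1) :=
    tendsto_natCast_div_add_atTop 1
  have hlow : Tendsto (fun k : ℕ => S (n k) / (k : ℝ) ^ 2 * ((k : ℝ) / ((k : ℝ) + 1)) ^ 2)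
      atTop (nhds 1) := by simpa using hT.mul (hr.pow 2)
  have hup : Tendsto (fun k : ℕ => S (n (k + 1)) / ((k + 1 : ℕ) : ℝ) ^ 2 *
      (((k : ℝ) / ((k : ℝ) + 1)) ^ 2)⁻¹) atTop (nhds 1) := by
    simpa using (hT.comp (tendsto_add_atTop_nat 1)).mul ((hr.pow 2).inv₀ (by norm_num))
  refine tendsto_of_tendsto_of_tendsto_of_le_of_le' (hlow.comp hk) (hup.comp hk) ?_ ?_
  all_goals
    filter_upwards [hdiv.eventually_ge_atTop 1, hk.eventually_ge_atTop 1] with N hN hkN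
    simp only [Function.comp]
    have hfl := Nat.floor_le (Real.sqrt_nonneg (E N))
    have hfl2 := Nat.lt_floor_add_one (Real.sqrt (E N))
    generalize ⌊Real.sqrt (E N)⌋₊ = k at *
    have hk0 : (1 : ℝ) ≤ k := by exact_mod_cast hkN
    have hsq := Real.sq_sqrt (show 0 ≤ E N by linarith)
    have hle : (k : ℝ) ^ 2 ≤ E N := by rw [← hsq]; gcongr
    have hlt : E N < ((k : ℝ) + 1) ^ 2 := by rw [← hsq]; gcongr
    have ha : n k ≤ N := hn2 _ _ hle
    have hb : N ≤ n (k + 1) := by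
      by_contra hcon
      have h1 := hn1 (k + 1)
      have h2 := hE (not_le.mp hcon).le
      push_cast at h1
      linarith
  · calc S (n k) / (k : ℝ) ^ 2 * ((k : ℝ) / ((k : ℝ) + 1)) ^ 2
        = S (n k) / ((k : ℝ) + 1) ^ 2 := by field_simp
      _ ≤ S N / E N := by
        have := hS ha
        have := hS0 N
        gcongr
  · calc S N / E N ≤ S (n (k + 1)) / (k : ℝ) ^ 2 := by
          have := hS hb
          have := hS0 (n (k + 1))
          gcongr
      _ = _ := by push_cast; field_simp

theorem stmt3 (g : ℕ → ℝ → ℝ) (C₁ C₂ : ℝ) (hC₁ : 0 < C₁) (hC₂ : 0 < C₂)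
    (hmeas : ∀ i, Measurable (g i)) (hnonneg : ∀ i x, 0 ≤ g i x)
    (hbdd : ∀ i x, g i x ≤ C₂)
    (hdiv : Tendsto (fun N => ∑ i ∈ Finset.Icc 1 N, ∫ x in Set.Icc (0:ℝ) 1, g i x)
      atTop atTop)
    (hcorr : ∀ i N, i < N →
      ∑ j ∈ Finset.Icc (i + 1) N,
          ((∫ x in Set.Icc (0:ℝ) 1, g j x * g i x) -
            (∫ x in Set.Icc (0:ℝ) 1, g i x) * (∫ x in Set.Icc (0:ℝ) 1, g j x))
        ≤ C₁ * ∫ x in Set.Icc (0:ℝ) 1, g i x) :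
    ∀ᵐ x ∂(volume.restrict (Set.Icc (0:ℝ) 1)),
      Tendsto (fun N =>
          (∑ i ∈ Finset.Icc 1 N, g i x) /
          (∑ i ∈ Finset.Icc 1 N, ∫ y in Set.Icc (0:ℝ) 1, g i y)) atTop (nhds 1) := by
  have hprob : IsProbabilityMeasure (volume.restrict (Set.Icc (0:ℝ) 1)) :=
    ⟨by simp⟩
  generalize volume.restrict (Set.Icc (0:ℝ) 1) = μ at *
  set m : ℕ → ℝ := fun i => ∫ x, g i x ∂μ with hm
  set E : ℕ → ℝ := fun N => ∑ i ∈ Finset.Icc 1 N, m i with hEdef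
  set S : ℕ → ℝ → ℝ := fun N x => ∑ i ∈ Finset.Icc 1 N, g i x with hSdef
  have hgi : ∀ i, Integrable (g i) μ := fun i =>
    Integrable.of_bound (hmeas i).aestronglyMeasurable C₂
      (Eventually.of_forall fun x => by
        rw [Real.norm_of_nonneg (hnonneg i x)]; exact hbdd i x)
  have hggi : ∀ i j, Integrable (fun x => g j x * g i x) μ := fun i j =>
    (hgi i).bdd_mul (c := C₂) (hmeas j).aestronglyMeasurable
      (Eventually.of_forall fun x => by
        rw [Real.norm_of_nonneg (hnonneg j x)]; exact hbdd j x)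
  have hm0 : ∀ i, 0 ≤ m i := fun i => integral_nonneg (hnonneg i)
  have hmC : ∀ i, m i ≤ C₂ := fun i => by
    have := integral_mono (hgi i) (integrable_const C₂) (hbdd i)
    simpa using this
  have hSm : ∀ N, Measurable (S N) := fun N =>
    Finset.measurable_fun_sum _ fun i _ => hmeas i
  have hSi : ∀ N, Integrable (S N) μ := fun N => integrable_finsetSum _ fun i _ => hgi i
  have hSE : ∀ N, ∫ x, S N x ∂μ = E N := fun N => integral_finsetSum _ fun i _ => hgi i
  have hS2 : ∀ N x, S N x ^ 2 =
      ∑ i ∈ Finset.Icc 1 N, ∑ j ∈ Finset.Icc 1 N, g j x * g i x := fun N x => by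
    simp only [hSdef]
    rw [sq, Finset.sum_mul_sum, Finset.sum_comm]
  have hS2i : ∀ N, Integrable (fun x => S N x ^ 2) μ := fun N => by
    simp_rw [hS2]
    exact integrable_finsetSum _ fun i _ => integrable_finsetSum _ fun j _ => hggi i j
  have hS2E : ∀ N, ∫ x, S N x ^ 2 ∂μ =
      ∑ i ∈ Finset.Icc 1 N, ∑ j ∈ Finset.Icc 1 N, ∫ x, g j x * g i x ∂μ := fun N => by
    simp_rw [hS2]
    rw [integral_finsetSum _ fun i _ => integrable_finsetSum _ fun j _ => hggi i j]
    exact Finset.sum_congr rfl fun i _ => integral_finsetSum _ fun j _ => hggi i j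
  have hexp : ∀ N x, (S N x - E N) ^ 2 = S N x ^ 2 - 2 * E N * S N x + E N ^ 2 :=
    fun N x => by ring
  have hVi : ∀ N, Integrable (fun x => (S N x - E N) ^ 2) μ := fun N => by
    simp_rw [hexp]
    exact ((hS2i N).sub ((hSi N).const_mul _)).add (integrable_const _)
  have hV : ∀ N, ∫ x, (S N x - E N) ^ 2 ∂μ =
      ∑ i ∈ Finset.Icc 1 N, ∑ j ∈ Finset.Icc 1 N,
        ((∫ x, g j x * g i x ∂μ) - m i * m j) := fun N => by
    simp_rw [hexp]
    have hsub : Integrable (fun x => S N x ^ 2 - 2 * E N * S N x) μ :=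
      (hS2i N).sub ((hSi N).const_mul _)
    rw [integral_add hsub (integrable_const _),
      integral_sub (hS2i N) ((hSi N).const_mul _), integral_const_mul, hSE, hS2E]
    simp_rw [Finset.sum_sub_distrib]
    rw [← Finset.sum_mul_sum]
    simp
    ring
  have hVb : ∀ N, ∫ x, (S N x - E N) ^ 2 ∂μ ≤ (C₂ + 2 * C₁) * E N := fun N => by
    rw [hV, aux_double (fun i j => (∫ x, g j x * g i x ∂μ) - m i * m j)
      (fun i j => by simp only [mul_comm])]
    have h1 : ∑ i ∈ Finset.Icc 1 N, ((∫ x, g i x * g i x ∂μ) - m i * m i) ≤ C₂ * E N := by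
      rw [hEdef, Finset.mul_sum]
      refine Finset.sum_le_sum fun i _ => ?_
      have : ∫ x, g i x * g i x ∂μ ≤ ∫ x, C₂ * g i x ∂μ :=
        integral_mono (hggi i i) ((hgi i).const_mul _) fun x =>
          mul_le_mul_of_nonneg_right (hbdd i x) (hnonneg i x)
      rw [integral_const_mul] at this
      nlinarith [mul_self_nonneg (m i)]
    have h2 : ∑ i ∈ Finset.Icc 1 N, ∑ j ∈ Finset.Icc (i + 1) N,
        ((∫ x, g j x * g i x ∂μ) - m i * m j) ≤ C₁ * E N := by
      rw [hEdef, Finset.mul_sum]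
      refine Finset.sum_le_sum fun i hi => ?_
      rcases lt_or_ge i N with h | h
      · exact hcorr i N h
      · rw [Finset.Icc_eq_empty (by omega), Finset.sum_empty]
        exact mul_nonneg hC₁.le (hm0 i)
    linarith
  have hmono : ∀ f : ℕ → ℝ, (∀ i, 0 ≤ f i) → Monotone fun N => ∑ i ∈ Finset.Icc 1 N, f i :=
    fun f hf a b hab => Finset.sum_le_sum_of_subset_of_nonneg
      (Finset.Icc_subset_Icc_right hab) fun i _ _ => hf i
  have hEx : ∀ k : ℕ, ∃ N, (k : ℝ) ^ 2 ≤ E N := fun k => (hdiv.eventually_ge_atTop _).exists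
  classical
  set n : ℕ → ℕ := fun k => Nat.find (hEx k) with hn
  have hn1 : ∀ k : ℕ, (k : ℝ) ^ 2 ≤ E (n k) := fun k => Nat.find_spec (hEx k)
  have hn2 : ∀ k N : ℕ, (k : ℝ) ^ 2 ≤ E N → n k ≤ N := fun k N h => Nat.find_min' (hEx k) h
  have hn3 : ∀ k : ℕ, E (n k) ≤ (k : ℝ) ^ 2 + C₂ := fun k => by
    rcases hN : n k with _ | N
    · simp only [hEdef]
      simp
      positivity
    · have h1 : E N < (k : ℝ) ^ 2 := by
        by_contra hcon
        have := hn2 k N (not_lt.mp hcon)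
        omega
      have h2 : E (N + 1) = E N + m (N + 1) := Finset.sum_Icc_succ_top (by omega) _
      linarith [hmC (N + 1)]
  have hsum : Summable fun k : ℕ => (C₂ + 2 * C₁) * (1 + C₂) * (1 / (k : ℝ) ^ 2) :=
    (Real.summable_one_div_nat_pow.mpr (by norm_num)).mul_left _
  have hae := aux_ae μ (fun k x => (S (n k) x - E (n k)) ^ 2 / (k : ℝ) ^ 4)
    (fun k => (((hSm _).sub_const _).pow_const 2).div_const _)
    (fun k x => by positivity) (fun k => (hVi _).div_const _) _ hsum (fun k => by
      rw [integral_div]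
      rcases Nat.eq_zero_or_pos k with rfl | hk
      · simp
      have hk1 : (1 : ℝ) ≤ k := by exact_mod_cast hk
      calc _ ≤ (C₂ + 2 * C₁) * ((1 + C₂) * (k : ℝ) ^ 2) / (k : ℝ) ^ 4 := by
            have h := hVb (n k)
            have h3 : E (n k) ≤ (1 + C₂) * (k : ℝ) ^ 2 := by
              nlinarith [hn3 k, one_le_pow₀ hk1 (n := 2)]
            have h4 := h.trans (mul_le_mul_of_nonneg_left h3 (by positivity))
            gcongr
        _ = _ := by field_simp)
  have hEk : Tendsto (fun k : ℕ => E (n k) / (k : ℝ) ^ 2) atTop (nhds 1) := by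
    have hz : Tendsto (fun k : ℕ => C₂ * (1 / (k : ℝ) ^ 2)) atTop (nhds 0) := by
      simpa using ((Real.summable_one_div_nat_pow.mpr
        (by norm_num : 1 < 2)).tendsto_atTop_zero).const_mul C₂
    refine tendsto_of_tendsto_of_tendsto_of_le_of_le' tendsto_const_nhds
      (by simpa using hz.const_add 1 : Tendsto (fun k : ℕ => 1 + C₂ * (1 / (k : ℝ) ^ 2))
        atTop (nhds 1)) ?_ ?_
    all_goals
      filter_upwards [eventually_ge_atTop 1] with k hk
      have hk1 : (0 : ℝ) < (k : ℝ) ^ 2 := by positivity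
    · rw [le_div_iff₀ hk1]; linarith [hn1 k]
    · rw [div_le_iff₀ hk1]
      have : (1 + C₂ * (1 / (k : ℝ) ^ 2)) * (k : ℝ) ^ 2 = (k : ℝ) ^ 2 + C₂ := by field_simp
      linarith [hn3 k]
  filter_upwards [hae] with x hx
  refine aux_interp (fun N => S N x) E (hmono _ fun i => hnonneg i x)
    (fun N => Finset.sum_nonneg fun i _ => hnonneg i x) (hmono _ hm0) hdiv n hn1 hn2 ?_
  have habs : Tendsto (fun k : ℕ => (S (n k) x - E (n k)) / (k : ℝ) ^ 2) atTop (nhds 0) := by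
    rw [tendsto_zero_iff_abs_tendsto_zero]
    have h := (Real.continuous_sqrt.tendsto 0).comp hx
    rw [Real.sqrt_zero] at h
    refine h.congr fun k => ?_
    simp only [Function.comp]
    rw [← Real.sqrt_sq_eq_abs, div_pow]
    congr 2
    ring
  have := habs.add hEk
  rw [zero_add] at this
  refine this.congr fun k => ?_
  ring
end

section
/- Let H_i : [0,1) → [0,∞) be measurable functions and (C_N) a nondecreasing sequence of positive reals with C_N → ∞, such that: (1) for every ε > 0 there exists M such that Σ_{i=1}^N ∫ H_i dλ < ε·C_N for all N ≥ M; (2) there exists C₀ > 0 such that for every N, every i ≤ N and every x, H_i(x) ≤ C₀·C_N^{2/3}; (3) there exists C₂ > 0 such that for every N and every i < N, Σ_{j=i+1}^{N} ∫ H_i H_j dλ ≤ C₂·C_N^{2/3}·∫ H_i dλ. Then for Lebesgue-almost every x ∈ [0,1), lim_{N→∞} (Σ_{i=1}^N H_i(x)) / C_N = 0. -/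
open MeasureTheory Filter Set

lemma sq_sum_aux (a : ℕ → ℝ) (N : ℕ) :
    (∑ i ∈ Finset.Icc 1 N, a i) ^ 2 =
      ∑ i ∈ Finset.Icc 1 N, (a i * a i + 2 * ∑ j ∈ Finset.Icc (i + 1) N, a i * a j) := by
  induction N with
  | zero => simp
  | succ n ih =>
    rw [Finset.sum_Icc_succ_top (by omega), Finset.sum_Icc_succ_top (by omega), add_sq, ih]
    have : ∑ i ∈ Finset.Icc 1 n, (a i * a i + 2 * ∑ j ∈ Finset.Icc (i + 1) (n + 1), a i * a j)
        = ∑ i ∈ Finset.Icc 1 n, ((a i * a i + 2 * ∑ j ∈ Finset.Icc (i + 1) n, a i * a j)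
          + 2 * a (n + 1) * a i) := by
      refine Finset.sum_congr rfl fun i hi => ?_
      have := (Finset.mem_Icc.1 hi).2
      rw [Finset.sum_Icc_succ_top (by omega)]
      ring
    rw [this, Finset.sum_add_distrib (g := fun i => 2 * a (n + 1) * a i), ← Finset.mul_sum]
    simp
    ring

theorem stmt4 (H : ℕ → ℝ → ℝ) (C : ℕ → ℝ)
    (hmeas : ∀ i, Measurable (H i)) (hnonneg : ∀ i x, 0 ≤ H i x)
    (hCpos : ∀ N, 0 < C N) (hCmono : Monotone C) (hCtop : Tendsto C atTop atTop)
    (h1 : ∀ ε : ℝ, 0 < ε → ∃ M : ℕ, ∀ N ≥ M,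
      ∑ i ∈ Finset.Icc 1 N, ∫ x in Set.Ico (0:ℝ) 1, H i x < ε * C N)
    (h2 : ∃ C₀ : ℝ, 0 < C₀ ∧ ∀ N : ℕ, ∀ i ≤ N, ∀ x : ℝ, H i x ≤ C₀ * (C N) ^ ((2:ℝ)/3))
    (h3 : ∃ C₂ : ℝ, 0 < C₂ ∧ ∀ N : ℕ, ∀ i < N,
      ∑ j ∈ Finset.Icc (i + 1) N, ∫ x in Set.Ico (0:ℝ) 1, H i x * H j x
        ≤ C₂ * (C N) ^ ((2:ℝ)/3) * ∫ x in Set.Ico (0:ℝ) 1, H i x) :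
    ∀ᵐ x ∂(volume.restrict (Set.Ico (0:ℝ) 1)),
      Tendsto (fun N => (∑ i ∈ Finset.Icc 1 N, H i x) / C N) atTop (nhds 0) := by
  obtain ⟨C₀, hC₀, h2⟩ := h2
  obtain ⟨C₂, hC₂, h3⟩ := h3
  set μ : Measure ℝ := volume.restrict (Set.Ico (0:ℝ) 1) with hμ
  have hfin : IsFiniteMeasure μ := ⟨by simp [hμ]⟩
  have hI : ∀ i, Integrable (H i) μ := fun i =>
    Integrable.of_bound (hmeas i).aestronglyMeasurable (C₀ * (C i) ^ ((2:ℝ)/3))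
      (ae_of_all _ fun x => by
        rw [Real.norm_of_nonneg (hnonneg i x)]; exact h2 i i le_rfl x)
  have hII : ∀ i j, Integrable (fun x => H i x * H j x) μ := fun i j =>
    Integrable.of_bound ((hmeas i).mul (hmeas j)).aestronglyMeasurable
      ((C₀ * (C i) ^ ((2:ℝ)/3)) * (C₀ * (C j) ^ ((2:ℝ)/3)))
      (ae_of_all _ fun x => by
        rw [Real.norm_of_nonneg (mul_nonneg (hnonneg i x) (hnonneg j x))]
        exact mul_le_mul (h2 i i le_rfl x) (h2 j j le_rfl x) (hnonneg j x)
          ((hnonneg i x).trans (h2 i i le_rfl x)))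
  have hI0 : ∀ i, 0 ≤ ∫ x, H i x ∂μ := fun i => integral_nonneg (hnonneg i)
  -- first moment
  obtain ⟨D, hD, h1'⟩ : ∃ D : ℝ, 0 < D ∧ ∀ N, ∑ i ∈ Finset.Icc 1 N, ∫ x, H i x ∂μ ≤ D * C N := by
    obtain ⟨M, hM⟩ := h1 1 one_pos
    have hp : 0 < C M / C 0 := div_pos (hCpos _) (hCpos _)
    refine ⟨1 + C M / C 0, by positivity, fun N => ?_⟩
    rcases le_total M N with h | h
    · refine (hM N h).le.trans ?_
      nlinarith [hCpos N]
    · have e1 : ∑ i ∈ Finset.Icc 1 N, ∫ x, H i x ∂μ ≤ ∑ i ∈ Finset.Icc 1 M, ∫ x, H i x ∂μ :=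
        Finset.sum_le_sum_of_subset_of_nonneg (Finset.Icc_subset_Icc le_rfl h)
          fun i _ _ => hI0 i
      have e2 := hM M le_rfl
      have e3 : C M = C M / C 0 * C 0 := by field_simp [(hCpos 0).ne']
      have e4 : C M / C 0 * C 0 ≤ C M / C 0 * C N :=
        mul_le_mul_of_nonneg_left (hCmono (Nat.zero_le _)) hp.le
      have := hCpos N
      linarith
  -- second moment
  have hS2int : ∀ N, Integrable (fun x => (∑ i ∈ Finset.Icc 1 N, H i x) ^ 2) μ := fun N => by
    simp_rw [sq, Finset.sum_mul_sum]
    exact integrable_finsetSum _ fun i _ => integrable_finsetSum _ fun j _ => hII i j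
  have hS2 : ∀ N, ∫ x, (∑ i ∈ Finset.Icc 1 N, H i x) ^ 2 ∂μ
      ≤ (C₀ + 2 * C₂) * (C N) ^ ((2:ℝ)/3) * (D * C N) := fun N => by
    have hr : 0 ≤ (C N) ^ ((2:ℝ)/3) := Real.rpow_nonneg (hCpos N).le _
    have hinner : ∀ i, Integrable (fun x => ∑ j ∈ Finset.Icc (i + 1) N, H i x * H j x) μ :=
      fun i => integrable_finsetSum _ fun j _ => hII i j
    calc _ = ∑ i ∈ Finset.Icc 1 N, ((∫ x, H i x * H i x ∂μ)
          + 2 * ∑ j ∈ Finset.Icc (i + 1) N, ∫ x, H i x * H j x ∂μ) := by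
            simp_rw [fun x => sq_sum_aux (fun i => H i x) N]
            have hadd : ∀ i, Integrable (fun x => H i x * H i x
                + 2 * ∑ j ∈ Finset.Icc (i + 1) N, H i x * H j x) μ :=
              fun i => (hII i i).add ((hinner i).const_mul 2)
            rw [integral_finsetSum _ fun i _ => hadd i]
            refine Finset.sum_congr rfl fun i _ => ?_
            rw [integral_add (hII i i) ((hinner i).const_mul 2), integral_const_mul,
              integral_finsetSum _ fun j _ => hII i j]
      _ ≤ ∑ i ∈ Finset.Icc 1 N, (C₀ + 2 * C₂) * (C N) ^ ((2:ℝ)/3) * ∫ x, H i x ∂μ := by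
            refine Finset.sum_le_sum fun i hi => ?_
            have hiN := (Finset.mem_Icc.1 hi).2
            have a1 : ∫ x, H i x * H i x ∂μ ≤ C₀ * (C N) ^ ((2:ℝ)/3) * ∫ x, H i x ∂μ := by
              rw [← integral_const_mul]
              exact integral_mono (hII i i) ((hI i).const_mul _) fun x =>
                mul_le_mul_of_nonneg_right (h2 N i hiN x) (hnonneg i x)
            have a2 : ∑ j ∈ Finset.Icc (i + 1) N, ∫ x, H i x * H j x ∂μ
                ≤ C₂ * (C N) ^ ((2:ℝ)/3) * ∫ x, H i x ∂μ := by
              rcases hiN.lt_or_eq with h | h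
              · exact h3 N i h
              · subst h
                have := hI0 i
                simp only [Finset.Icc_eq_empty (show ¬ (i + 1 ≤ i) by omega), Finset.sum_empty]
                positivity
            linarith
      _ ≤ _ := by
            rw [← Finset.mul_sum]
            exact mul_le_mul_of_nonneg_left (h1' N) (by positivity)
  -- subsequence
  have hL : ∀ k : ℕ, ∃ L : ℕ, (∀ N, C N < 2 ^ (k + 1) → N ≤ L) ∧ (L = 0 ∨ C L < 2 ^ (k + 1)) := by
    intro k
    classical
    obtain ⟨B, hB⟩ := (hCtop.eventually_ge_atTop ((2:ℝ) ^ (k + 1))).exists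
    refine ⟨Nat.findGreatest (fun N => C N < 2 ^ (k + 1)) B, fun N hN => ?_, ?_⟩
    · refine Nat.le_findGreatest ?_ hN
      by_contra h
      have := hCmono (not_le.1 h).le
      linarith
    · by_cases h : Nat.findGreatest (fun N => C N < 2 ^ (k + 1)) B = 0
      · exact Or.inl h
      · exact Or.inr (Nat.findGreatest_of_ne_zero rfl h)
  choose L hL1 hL2 using hL
  set q : ℝ := (2:ℝ) ^ ((2:ℝ)/3) with hq
  have hq0 : 0 < q := by positivity
  have hq2 : q < 2 := by
    have := Real.rpow_lt_rpow_of_exponent_lt (x := 2) (by norm_num) (show (2:ℝ)/3 < 1 by norm_num)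
    simpa using this
  have hgint : ∀ k, Integrable (fun x => ((∑ i ∈ Finset.Icc 1 (L k), H i x) / 2 ^ k) ^ 2) μ :=
    fun k => by
      simp_rw [div_pow]
      exact (hS2int (L k)).div_const _
  set K : ℝ := (C₀ + 2 * C₂) * D * 2 * q with hK
  have hK0 : 0 < K := by positivity
  have hg : ∀ k, ∫ x, ((∑ i ∈ Finset.Icc 1 (L k), H i x) / 2 ^ k) ^ 2 ∂μ ≤ K * (q / 2) ^ k := by
    intro k
    rcases hL2 k with h | h
    · rw [h]
      simp
      positivity
    · simp_rw [div_pow]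
      rw [integral_div, div_le_iff₀ (by positivity)]
      refine (hS2 _).trans ?_
      have b1 : (C (L k)) ^ ((2:ℝ)/3) ≤ q ^ (k + 1) := by
        have : q ^ (k + 1) = ((2:ℝ) ^ (k + 1)) ^ ((2:ℝ)/3) := by
          rw [hq, ← Real.rpow_natCast, ← Real.rpow_natCast, ← Real.rpow_mul (by norm_num),
            ← Real.rpow_mul (by norm_num), mul_comm]
        rw [this]
        exact Real.rpow_le_rpow (hCpos _).le h.le (by norm_num)
      have hc := hCpos (L k)
      calc (C₀ + 2 * C₂) * (C (L k)) ^ ((2:ℝ)/3) * (D * C (L k))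
          ≤ (C₀ + 2 * C₂) * q ^ (k + 1) * (D * 2 ^ (k + 1)) := by gcongr
        _ = _ := by
          rw [hK]
          field_simp
          ring
  have hsum : Summable fun k : ℕ => K * (q / 2) ^ k :=
    (summable_geometric_of_lt_one (by positivity) (by linarith)).mul_left K
  have hmeasg : ∀ k, Measurable fun x =>
      ENNReal.ofReal (((∑ i ∈ Finset.Icc 1 (L k), H i x) / 2 ^ k) ^ 2) := fun k =>
    (((Finset.measurable_fun_sum _ fun i _ => hmeas i).div_const _).pow_const 2).ennreal_ofReal
  have hlin : ∫⁻ x, ∑' k, ENNReal.ofReal (((∑ i ∈ Finset.Icc 1 (L k), H i x) / 2 ^ k) ^ 2) ∂μ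
      ≠ ⊤ := by
    rw [lintegral_tsum fun k => (hmeasg k).aemeasurable]
    refine ne_top_of_le_ne_top hsum.tsum_ofReal_ne_top (ENNReal.tsum_le_tsum fun k => ?_)
    rw [← ofReal_integral_eq_lintegral_ofReal (hgint k) (ae_of_all _ fun x => sq_nonneg _)]
    exact ENNReal.ofReal_le_ofReal (hg k)
  filter_upwards [ae_lt_top (Measurable.ennreal_tsum hmeasg) hlin] with x hx
  have t1 := ENNReal.tendsto_atTop_zero_of_tsum_ne_top hx.ne
  have t2 : Tendsto (fun k => (∑ i ∈ Finset.Icc 1 (L k), H i x) / 2 ^ k) atTop (nhds 0) := by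
    have := (ENNReal.tendsto_toReal ENNReal.zero_ne_top).comp t1
    have t3 := (Real.continuous_sqrt.tendsto _).comp this
    simp only [ENNReal.toReal_zero, Real.sqrt_zero] at t3
    refine t3.congr fun k => ?_
    simp only [Function.comp]
    rw [ENNReal.toReal_ofReal (sq_nonneg _), Real.sqrt_sq]
    exact div_nonneg (Finset.sum_nonneg fun i _ => hnonneg i x) (by positivity)
  have hk : Tendsto (fun N => Nat.log 2 ⌊C N⌋₊) atTop atTop := by
    refine Tendsto.comp (g := Nat.log 2) ?_ (tendsto_nat_floor_atTop.comp hCtop)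
    exact tendsto_atTop_atTop.2 fun b => ⟨2 ^ b, fun a ha =>
      Nat.le_log_of_pow_le (by norm_num) ha⟩
  refine squeeze_zero' (Eventually.of_forall fun N =>
    div_nonneg (Finset.sum_nonneg fun i _ => hnonneg i x) (hCpos N).le) ?_ (t2.comp hk)
  filter_upwards [hCtop.eventually_ge_atTop 1] with N hN
  simp only [Function.comp]
  have hf : ⌊C N⌋₊ ≠ 0 := (Nat.floor_pos.2 hN).ne'
  have l1 : (2:ℝ) ^ (Nat.log 2 ⌊C N⌋₊) ≤ C N := by
    have := (Nat.le_floor_iff (hCpos N).le).1 (Nat.pow_log_le_self 2 hf)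
    exact_mod_cast this
  have l2 : C N < 2 ^ (Nat.log 2 ⌊C N⌋₊ + 1) := by
    have := (Nat.floor_lt (hCpos N).le).1 (Nat.lt_pow_succ_log_self (b := 2) (by norm_num) ⌊C N⌋₊)
    exact_mod_cast this
  refine div_le_div₀ (Finset.sum_nonneg fun i _ => hnonneg i x) ?_ (by positivity) l1
  exact Finset.sum_le_sum_of_subset_of_nonneg (Finset.Icc_subset_Icc le_rfl (hL1 _ _ l2))
    fun i _ _ => hnonneg i x
end

section
/- Let T : [0,1) → [0,1) be a Lebesgue-measure-preserving transformation, let J ⊆ [0,1) be an interval, let h : [0,1) → [0,∞) be integrable, let n ≥ 1 and δ, δ' ≥ 0. Assume ‖h − h∘T^i‖_{L¹} ≤ δ for all 1 ≤ i ≤ n, and that for every x ∈ [0,1), | n·λ(J) − #{1 ≤ i ≤ n : T^i x ∈ J} | < n·δ'. Then ∫ h·χ_J dλ − λ(J)·∫ h dλ ≤ (λ(J) + δ')·∫ h dλ + δ. -/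
open MeasureTheory Filter Set

theorem stmt5 (T : ℝ → ℝ)
    (hTmaps : Set.MapsTo T (Set.Ico (0:ℝ) 1) (Set.Ico (0:ℝ) 1))
    (hTpres : MeasurePreserving T (volume.restrict (Set.Ico (0:ℝ) 1))
      (volume.restrict (Set.Ico (0:ℝ) 1)))
    (J : Set ℝ) (hJsub : J ⊆ Set.Ico (0:ℝ) 1) (hJint : J.OrdConnected)
    (hJmeas : MeasurableSet J)
    (h : ℝ → ℝ) (hh : Integrable h (volume.restrict (Set.Ico (0:ℝ) 1)))
    (hpos : ∀ x, 0 ≤ h x)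
    (n : ℕ) (hn : 1 ≤ n) (δ δ' : ℝ) (hδ : 0 ≤ δ) (hδ' : 0 ≤ δ')
    (hinv : ∀ i : ℕ, 1 ≤ i → i ≤ n →
      (∫ x in Set.Ico (0:ℝ) 1, |h x - h (T^[i] x)|) ≤ δ)
    (hcount : ∀ x ∈ Set.Ico (0:ℝ) 1,
      |(n : ℝ) * (volume J).toReal -
        ∑ i ∈ Finset.Icc 1 n, Set.indicator J (fun _ => (1:ℝ)) (T^[i] x)| < n * δ') :
    (∫ x in Set.Ico (0:ℝ) 1, h x * Set.indicator J (fun _ => (1:ℝ)) x) -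
        (volume J).toReal * ∫ x in Set.Ico (0:ℝ) 1, h x
      ≤ ((volume J).toReal + δ') * (∫ x in Set.Ico (0:ℝ) 1, h x) + δ := by
  set μ := volume.restrict (Set.Ico (0:ℝ) 1) with hμ
  set χ : ℝ → ℝ := Set.indicator J (fun _ => (1:ℝ)) with hχ
  have hχm : Measurable χ := measurable_const.indicator hJmeas
  have hχ0 : ∀ x, 0 ≤ χ x := fun x => Set.indicator_nonneg (fun _ _ => zero_le_one) x
  have hχ1 : ∀ x, χ x ≤ 1 := fun x => Set.indicator_le_self' (fun _ _ => zero_le_one) x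
  have hmul : ∀ (f g : ℝ → ℝ), Integrable f μ → Measurable g → (∀ x, 0 ≤ g x) →
      (∀ x, g x ≤ 1) → Integrable (fun x => f x * g x) μ := by
    intro f g hf hg h0 h1
    refine hf.mul_bdd (c := 1) hg.aestronglyMeasurable (Eventually.of_forall fun x => ?_)
    rw [Real.norm_eq_abs, abs_of_nonneg (h0 x)]
    exact h1 x
  have hTi : ∀ i : ℕ, MeasurePreserving (T^[i]) μ μ := fun i => hTpres.iterate i
  have hhi : ∀ i : ℕ, Integrable (fun x => h (T^[i] x)) μ := fun i =>
    (hTi i).integrable_comp_of_integrable hh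
  have hint : ∀ i : ℕ, Integrable (fun x => h x * χ (T^[i] x)) μ := fun i =>
    hmul h (fun x => χ (T^[i] x)) hh (hχm.comp (hTi i).measurable)
      (fun x => hχ0 _) (fun x => hχ1 _)
  have hI0 : 0 ≤ ∫ x, h x ∂μ := integral_nonneg hpos
  have key : ∀ i ∈ Finset.Icc 1 n,
      (∫ x, h x * χ x ∂μ) ≤ δ + ∫ x, h x * χ (T^[i] x) ∂μ := by
    intro i hi
    rw [Finset.mem_Icc] at hi
    have e : (∫ x, h x * χ x ∂μ) = ∫ x, h (T^[i] x) * χ (T^[i] x) ∂μ := by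
      have hsm : AEStronglyMeasurable (fun x => h x * χ x) (Measure.map (T^[i]) μ) := by
        rw [(hTi i).map_eq]
        exact (hmul h χ hh hχm hχ0 hχ1).aestronglyMeasurable
      have := integral_map (hTi i).measurable.aemeasurable hsm
      rw [(hTi i).map_eq] at this
      exact this
    have hd : Integrable (fun x => |h x - h (T^[i] x)|) μ := (hh.sub (hhi i)).abs
    rw [e]
    calc (∫ x, h (T^[i] x) * χ (T^[i] x) ∂μ)
        ≤ ∫ x, (|h x - h (T^[i] x)| + h x * χ (T^[i] x)) ∂μ := by
          refine integral_mono (hmul _ (fun x => χ (T^[i] x)) (hhi i)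
            (hχm.comp (hTi i).measurable) (fun x => hχ0 _) (fun x => hχ1 _))
            (hd.add (hint i)) (fun x => ?_)
          have a0 := hχ0 (T^[i] x)
          have a1 := hχ1 (T^[i] x)
          have b := neg_abs_le (h x - h (T^[i] x))
          have c := abs_nonneg (h x - h (T^[i] x))
          show h (T^[i] x) * χ (T^[i] x) ≤ |h x - h (T^[i] x)| + h x * χ (T^[i] x)
          nlinarith
      _ = (∫ x, |h x - h (T^[i] x)| ∂μ) + ∫ x, h x * χ (T^[i] x) ∂μ :=
          integral_add hd (hint i)
      _ ≤ _ := by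
          have := hinv i hi.1 hi.2
          linarith
  have hsum := Finset.sum_le_sum key
  rw [Finset.sum_add_distrib, ← integral_finsetSum _ (fun i _ => hint i)] at hsum
  simp only [Finset.sum_const, Nat.card_Icc, Nat.add_sub_cancel, nsmul_eq_mul] at hsum
  have hup : (∫ x, ∑ i ∈ Finset.Icc 1 n, h x * χ (T^[i] x) ∂μ)
      ≤ ∫ x, h x * (n * ((volume J).toReal + δ')) ∂μ := by
    refine integral_mono_ae (integrable_finsetSum _ (fun i _ => hint i)) (hh.mul_const _) ?_
    filter_upwards [ae_restrict_mem measurableSet_Ico] with x hx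
    rw [← Finset.mul_sum]
    refine mul_le_mul_of_nonneg_left ?_ (hpos x)
    have := (abs_lt.mp (hcount x hx)).1
    linarith
  rw [integral_mul_const] at hup
  have hn0 : (0:ℝ) < n := by exact_mod_cast hn
  have hfin : (∫ x, h x * χ x ∂μ) ≤ δ + (∫ x, h x ∂μ) * ((volume J).toReal + δ') := by
    refine le_of_mul_le_mul_left ?_ hn0
    linarith
  have hJ0 : 0 ≤ (volume J).toReal * ∫ x, h x ∂μ := mul_nonneg ENNReal.toReal_nonneg hI0
  linarith
end

section
/- For Lebesgue-almost every irrational α ∈ (0,1) and Lebesgue-almost every x ∈ [0,1), lim_{n→∞} ( log Σ_{j=1}^{n} χ_{V_j}(x) ) / ( log Σ_{j=1}^n λ(V_j) ) = 1. -/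
open MeasureTheory Filter Set

noncomputable def rot (α : ℝ) : ℝ → ℝ := fun x => Int.fract (x + α)

/-- The coding of the orbit of `x` under the rotation by `α` with respect to the
partition `{[0,α), [α,1)}`: `0` if `R_α^i x ∈ [0,α)` and `1` otherwise. -/
noncomputable def code (α x : ℝ) (i : ℕ) : ℕ :=
  if (rot α)^[i] x < α then 0 else 1

/-- The set of points of `[0,1)` that are undetermined at step `j`. -/
def undet (α : ℝ) (j : ℕ) : Set ℝ :=
  {x ∈ Set.Ico (0:ℝ) 1 | ∃ y ∈ Set.Ico (0:ℝ) 1,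
    (∀ i ≤ j, code α y i = code α x i) ∧ code α y (j + 1) ≠ code α x (j + 1)}


noncomputable def gm (x : ℝ) : ℝ := Int.fract (1 / x)

lemma gm_meas : Measurable gm := by
  unfold gm
  exact measurable_fract.comp (measurable_const.div measurable_id)

lemma gm_branch (n : ℕ) {y : ℝ} (hy : y ∈ Ico (0:ℝ) 1) : gm (1 / ((n:ℝ) + 1 + y)) = y := by
  unfold gm
  rw [one_div_one_div]
  have : (n:ℝ) + 1 + y = ((n + 1 : ℤ) : ℝ) + y := by push_cast; ring
  rw [this, Int.fract_intCast_add, Int.fract_eq_self.2 ⟨hy.1, hy.2⟩]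

lemma gm_cover : Ioo (0:ℝ) 1 ⊆ ⋃ n : ℕ, (fun y : ℝ => 1 / ((n:ℝ) + 1 + y)) '' Ico (0:ℝ) 1 := by
  intro x hx
  have h1 : 1 < 1 / x := by rw [lt_div_iff₀ hx.1]; linarith [hx.2]
  have h2 : 1 ≤ ⌊1 / x⌋ := by rw [Int.le_floor]; push_cast; exact h1.le
  obtain ⟨n, hn⟩ : ∃ n : ℕ, ⌊1 / x⌋ = n + 1 := ⟨(⌊1 / x⌋ - 1).toNat, by omega⟩
  refine mem_iUnion.2 ⟨n, Int.fract (1 / x), ⟨Int.fract_nonneg _, Int.fract_lt_one _⟩, ?_⟩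
  have h3 : (n:ℝ) + 1 + Int.fract (1 / x) = 1 / x := by
    have := Int.floor_add_fract (1 / x)
    rw [hn] at this
    push_cast at this
    exact this
  simp only [h3, one_div_one_div]

noncomputable def gw (x : ℝ) : ENNReal := ENNReal.ofReal (1 / (1 + x))

lemma gw_meas : Measurable gw := by
  unfold gw; fun_prop

lemma gauss_tsum {y : ℝ} (hy : y ∈ Ico (0:ℝ) 1) :
    ∑' n : ℕ, ENNReal.ofReal (1 / (((n:ℝ) + 1 + y) * ((n:ℝ) + 2 + y))) ≤ gw y := by
  refine ENNReal.tsum_le_of_sum_range_le fun N => ?_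
  have hy0 := hy.1
  rw [← ENNReal.ofReal_sum_of_nonneg (fun i _ => by positivity)]
  refine ENNReal.ofReal_le_ofReal ?_
  have : ∑ n ∈ Finset.range N, (1 / (((n:ℝ) + 1 + y) * ((n:ℝ) + 2 + y)))
      = 1 / (1 + y) - 1 / ((N:ℝ) + 1 + y) := by
    induction N with
    | zero => simp
    | succ N ih =>
      rw [Finset.sum_range_succ, ih]
      push_cast
      have : (N:ℝ) + 1 + y ≠ 0 := by positivity
      have : (N:ℝ) + 2 + y ≠ 0 := by positivity
      have : (N:ℝ) + 1 + 1 + y ≠ 0 := by positivity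
      have : 1 + y ≠ 0 := by positivity
      field_simp
      ring
  rw [this]
  have : 0 ≤ 1 / ((N:ℝ) + 1 + y) := by positivity
  linarith

lemma gauss_le (f : ℝ → ENNReal) (hf : Measurable f) :
    ∫⁻ x in Ico (0:ℝ) 1, f (gm x) * gw x ≤ ∫⁻ y in Ico (0:ℝ) 1, f y * gw y := by
  calc ∫⁻ x in Ico (0:ℝ) 1, f (gm x) * gw x = ∫⁻ x in Ioo (0:ℝ) 1, f (gm x) * gw x :=
        setLIntegral_congr Ioo_ae_eq_Ico.symm
    _ ≤ ∫⁻ x in ⋃ n : ℕ, (fun y : ℝ => 1 / ((n:ℝ) + 1 + y)) '' Ico (0:ℝ) 1, f (gm x) * gw x :=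
        lintegral_mono_set gm_cover
    _ ≤ ∑' n : ℕ, ∫⁻ x in (fun y : ℝ => 1 / ((n:ℝ) + 1 + y)) '' Ico (0:ℝ) 1, f (gm x) * gw x :=
        lintegral_iUnion_le _ _
    _ = ∑' n : ℕ, ∫⁻ y in Ico (0:ℝ) 1,
          f y * ENNReal.ofReal (1 / (((n:ℝ) + 1 + y) * ((n:ℝ) + 2 + y))) := by
        congr 1
        funext n
        rw [lintegral_image_eq_lintegral_abs_deriv_mul measurableSet_Ico
          (f' := fun y => -1 / ((n:ℝ) + 1 + y) ^ 2)]
        · refine setLIntegral_congr_fun measurableSet_Ico fun y hy => ?_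
          have hy0 := hy.1
          rw [gm_branch n hy, mul_left_comm]
          congr 1
          unfold gw
          rw [← ENNReal.ofReal_mul (abs_nonneg _)]
          congr 1
          rw [abs_div, abs_neg, abs_one, abs_of_nonneg (by positivity)]
          have : (n:ℝ) + 1 + y ≠ 0 := by positivity
          have : (n:ℝ) + 2 + y ≠ 0 := by positivity
          have : (n:ℝ) + 1 + y + 1 ≠ 0 := by positivity
          field_simp
          ring
        · intro y hy
          have hy0 := hy.1
          have h0 : (n:ℝ) + 1 + y ≠ 0 := by positivity
          have h1 : HasDerivAt (fun y : ℝ => (n:ℝ) + 1 + y) 1 y := by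
            simpa using (hasDerivAt_id y).const_add ((n:ℝ) + 1)
          have h2 := h1.inv h0
          simp only [one_div]
          exact h2.hasDerivWithinAt
        · intro a ha b hb hab
          have := congrArg gm hab
          simp only [gm_branch n ha, gm_branch n hb] at this
          exact this
    _ = ∫⁻ y in Ico (0:ℝ) 1, ∑' n : ℕ,
          f y * ENNReal.ofReal (1 / (((n:ℝ) + 1 + y) * ((n:ℝ) + 2 + y))) := by
        rw [lintegral_tsum]
        intro n
        exact (hf.mul (by fun_prop)).aemeasurable
    _ ≤ ∫⁻ y in Ico (0:ℝ) 1, f y * gw y := by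
        refine setLIntegral_mono (hf.mul gw_meas) fun y hy => ?_
        rw [ENNReal.tsum_mul_left]
        gcongr
        exact gauss_tsum hy

lemma gauss_iter_le (f : ℝ → ENNReal) (hf : Measurable f) (m : ℕ) :
    ∫⁻ x in Ico (0:ℝ) 1, f (gm^[m] x) * gw x ≤ ∫⁻ y in Ico (0:ℝ) 1, f y * gw y := by
  induction m with
  | zero => simp
  | succ m ih =>
    simp only [Function.iterate_succ_apply]
    exact (gauss_le (fun x => f (gm^[m] x)) (hf.comp (gm_meas.iterate m))).trans ih

lemma gauss_bound (f : ℝ → ENNReal) (hf : Measurable f) (m : ℕ) :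
    ∫⁻ x in Ico (0:ℝ) 1, f (gm^[m] x) ≤ 2 * ∫⁻ y in Ico (0:ℝ) 1, f y := by
  have h1 : ∫⁻ x in Ico (0:ℝ) 1, f (gm^[m] x)
      ≤ ∫⁻ x in Ico (0:ℝ) 1, 2 * (f (gm^[m] x) * gw x) := by
    refine setLIntegral_mono (((hf.comp (gm_meas.iterate m)).mul gw_meas).const_mul 2)
      fun x hx => ?_
    have hw : 1 ≤ 2 * gw x := by
      unfold gw
      have : (2:ENNReal) = ENNReal.ofReal 2 := by simp
      rw [this, ← ENNReal.ofReal_mul (by norm_num), ← ENNReal.ofReal_one]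
      refine ENNReal.ofReal_le_ofReal ?_
      have := hx.1
      have := hx.2
      rw [mul_one_div, le_div_iff₀ (by linarith)]
      linarith
    calc f (gm^[m] x) = f (gm^[m] x) * 1 := (mul_one _).symm
      _ ≤ f (gm^[m] x) * (2 * gw x) := by gcongr
      _ = _ := by ring
  have h2 : ∫⁻ y in Ico (0:ℝ) 1, f y * gw y ≤ ∫⁻ y in Ico (0:ℝ) 1, f y := by
    refine setLIntegral_mono hf fun x hx => ?_
    have hw : gw x ≤ 1 := by
      unfold gw
      rw [← ENNReal.ofReal_one]
      refine ENNReal.ofReal_le_ofReal ?_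
      have := hx.1
      rw [div_le_iff₀ (by linarith)]
      linarith
    calc f x * gw x ≤ f x * 1 := by gcongr
      _ = _ := mul_one _
  have hmm : Measurable (fun x => f (gm^[m] x) * gw x) := (hf.comp (gm_meas.iterate m)).mul gw_meas
  rw [lintegral_const_mul _ hmm] at h1
  exact h1.trans (mul_le_mul_right ((gauss_iter_le f hf m).trans h2) 2)

lemma metric_s (s : ℝ) (hs0 : 0 < s) (hs1 : s < 1) :
    ∀ᵐ α ∂(volume.restrict (Ico (0:ℝ) 1)),
      ∑' m : ℕ, ENNReal.ofReal ((gm^[m] α) ^ (-s)) * ENNReal.ofReal (((m:ℝ) + 1) ^ (-(1 / s))) < ⊤ := by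
  have hf : Measurable (fun x : ℝ => ENNReal.ofReal (x ^ (-s))) := by fun_prop
  have hf' : ∀ m : ℕ, Measurable (fun x : ℝ => ENNReal.ofReal ((gm^[m] x) ^ (-s))) :=
    fun m => hf.comp (gm_meas.iterate m)
  have hfm : ∀ m : ℕ, Measurable (fun x : ℝ => ENNReal.ofReal ((gm^[m] x) ^ (-s)) *
      ENNReal.ofReal (((m:ℝ) + 1) ^ (-(1 / s)))) := fun m => (hf' m).mul measurable_const
  refine ae_lt_top (Measurable.tsum hfm) ?_
  rw [lintegral_tsum (fun m => (hfm m).aemeasurable)]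
  have hK : ∫⁻ y in Ico (0:ℝ) 1, ENNReal.ofReal (y ^ (-s)) < ⊤ := by
    have h1 : IntervalIntegrable (fun x : ℝ => x ^ (-s)) volume 0 1 :=
      intervalIntegral.intervalIntegrable_rpow' (by linarith)
    rw [intervalIntegrable_iff_integrableOn_Ioc_of_le zero_le_one] at h1
    rw [setLIntegral_congr (Ico_ae_eq_Ioc (μ := volume) (a := (0:ℝ)) (b := 1))]
    exact h1.lintegral_lt_top
  have hc : ∑' m : ℕ, ENNReal.ofReal (((m:ℝ) + 1) ^ (-(1 / s))) ≠ ⊤ := by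
    have h1 : Summable (fun m : ℕ => (m:ℝ) ^ (-(1 / s))) := by
      rw [Real.summable_nat_rpow]
      have : 1 < 1 / s := by rw [lt_div_iff₀ hs0]; linarith
      linarith
    have h2 : Summable (fun m : ℕ => ((m:ℝ) + 1) ^ (-(1 / s))) := by
      have := (summable_nat_add_iff 1).2 h1
      simpa using this
    exact h2.tsum_ofReal_ne_top
  have hle : ∑' m : ℕ, ∫⁻ x in Ico (0:ℝ) 1,
      ENNReal.ofReal ((gm^[m] x) ^ (-s)) * ENNReal.ofReal (((m:ℝ) + 1) ^ (-(1 / s)))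
      ≤ ∑' m : ℕ, (2 * ∫⁻ y in Ico (0:ℝ) 1, ENNReal.ofReal (y ^ (-s)))
        * ENNReal.ofReal (((m:ℝ) + 1) ^ (-(1 / s))) := by
    refine ENNReal.tsum_le_tsum fun m => ?_
    rw [lintegral_mul_const _ (hf' m)]
    gcongr
    exact gauss_bound _ hf m
  rw [ENNReal.tsum_mul_left] at hle
  refine ne_top_of_le_ne_top ?_ hle
  exact ENNReal.mul_ne_top (ENNReal.mul_ne_top (by simp) hK.ne) hc

lemma sum_rpow_le (s : ℝ) (hs0 : 0 < s) (hs1 : s < 1) (y : ℕ → ℝ) (hy : ∀ m, 0 ≤ y m) (k : ℕ) :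
    (∑ m ∈ Finset.range k, y m) ^ s ≤ ∑ m ∈ Finset.range k, (y m) ^ s := by
  induction k with
  | zero => simp [Real.zero_rpow hs0.ne']
  | succ k ih =>
    rw [Finset.sum_range_succ, Finset.sum_range_succ]
    refine (Real.rpow_add_le_add_rpow (Finset.sum_nonneg fun i _ => hy i) (hy k) hs0.le hs1.le).trans ?_
    linarith

/-- bound for one exponent -/
lemma growth_s (s : ℝ) (hs0 : 0 < s) (hs1 : s < 1) (α : ℝ) (hα : ∀ m, 0 < gm^[m] α)
    (h : ∑' m : ℕ, ENNReal.ofReal ((gm^[m] α) ^ (-s)) *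
      ENNReal.ofReal (((m:ℝ) + 1) ^ (-(1 / s))) < ⊤) :
    ∃ C : ℝ, 0 < C ∧ ∀ k : ℕ, 1 ≤ k →
      ∑ m ∈ Finset.range k, 1 / gm^[m] α ≤ C * (k:ℝ) ^ (1 / s ^ 2) := by
  set T := ∑' m : ℕ, ENNReal.ofReal ((gm^[m] α) ^ (-s)) *
      ENNReal.ofReal (((m:ℝ) + 1) ^ (-(1 / s))) with hT
  have hfin : ∀ k : ℕ, ∑ m ∈ Finset.range k, (gm^[m] α) ^ (-s) * ((m:ℝ) + 1) ^ (-(1 / s))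
      ≤ T.toReal := by
    intro k
    have h1 := ENNReal.sum_le_tsum (f := fun m : ℕ => ENNReal.ofReal ((gm^[m] α) ^ (-s)) *
      ENNReal.ofReal (((m:ℝ) + 1) ^ (-(1 / s)))) (Finset.range k)
    rw [← hT] at h1
    have hnn : ∀ m : ℕ, 0 ≤ (gm^[m] α) ^ (-s) := fun m => Real.rpow_nonneg (hα m).le _
    simp only [← ENNReal.ofReal_mul (hnn _)] at h1
    rw [← ENNReal.ofReal_sum_of_nonneg (fun m _ => mul_nonneg (hnn m) (by positivity))] at h1
    exact (ENNReal.ofReal_le_iff_le_toReal h.ne).1 h1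
  refine ⟨(T.toReal + 1) ^ (1 / s), by positivity, fun k hk => ?_⟩
  have hk0 : (0:ℝ) < k := by exact_mod_cast hk
  have h2 : ∑ m ∈ Finset.range k, (1 / gm^[m] α) ^ s ≤ (T.toReal + 1) * (k:ℝ) ^ (1 / s) := by
    calc ∑ m ∈ Finset.range k, (1 / gm^[m] α) ^ s
        ≤ ∑ m ∈ Finset.range k, ((gm^[m] α) ^ (-s) * ((m:ℝ) + 1) ^ (-(1 / s))) * (k:ℝ) ^ (1 / s) := by
          refine Finset.sum_le_sum fun m hm => ?_
          have hmk : (m:ℝ) + 1 ≤ k := by exact_mod_cast Finset.mem_range.1 hm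
          have e1 : (1 / gm^[m] α) ^ s = (gm^[m] α) ^ (-s) := by
            rw [Real.rpow_neg (hα m).le, one_div, Real.inv_rpow (hα m).le]
          rw [e1, mul_assoc]
          refine le_mul_of_one_le_right (Real.rpow_nonneg (hα m).le _) ?_
          rw [Real.rpow_neg (by positivity), inv_mul_eq_div, one_le_div (by positivity)]
          exact Real.rpow_le_rpow (by positivity) hmk (by positivity)
      _ = (∑ m ∈ Finset.range k, (gm^[m] α) ^ (-s) * ((m:ℝ) + 1) ^ (-(1 / s))) * (k:ℝ) ^ (1 / s) := by
          rw [Finset.sum_mul]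
      _ ≤ _ := by
          gcongr
          linarith [hfin k]
  have h3 := (sum_rpow_le s hs0 hs1 (fun m => 1 / gm^[m] α)
    (fun m => by have := hα m; positivity) k).trans h2
  have hS : 0 ≤ ∑ m ∈ Finset.range k, 1 / gm^[m] α :=
    Finset.sum_nonneg fun m _ => by have := hα m; positivity
  have h4 := Real.rpow_le_rpow (Real.rpow_nonneg hS s) h3 (z := 1 / s) (by positivity)
  rw [← Real.rpow_mul hS, mul_one_div_cancel hs0.ne', Real.rpow_one,
    Real.mul_rpow (by positivity) (by positivity), ← Real.rpow_mul hk0.le] at h4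
  convert h4 using 3
  field_simp

lemma gm_irr {α : ℝ} (h : Irrational α) (h0 : α ∈ Ioo (0:ℝ) 1) :
    ∀ m, Irrational (gm^[m] α) ∧ gm^[m] α ∈ Ioo (0:ℝ) 1 := by
  intro m
  induction m with
  | zero => exact ⟨h, h0⟩
  | succ m ih =>
    rw [Function.iterate_succ_apply']
    have h1 : Irrational (gm (gm^[m] α)) := by
      unfold gm
      rw [one_div, Int.fract]
      exact ih.1.inv.sub_intCast _
    refine ⟨h1, lt_of_le_of_ne (Int.fract_nonneg _) (fun h => h1.ne_zero h.symm), Int.fract_lt_one _⟩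

lemma growth : ∀ᵐ α ∂(volume.restrict (Ioo (0:ℝ) 1)), Irrational α → α ∈ Ioo (0:ℝ) 1 →
    ∀ r : ℝ, 1 < r → ∃ C : ℝ, 0 < C ∧ ∀ k : ℕ, 1 ≤ k →
      ∑ m ∈ Finset.range k, 1 / gm^[m] α ≤ C * (k:ℝ) ^ r := by
  have h1 : ∀ N : ℕ, ∀ᵐ α ∂(volume.restrict (Ico (0:ℝ) 1)),
      ∑' m : ℕ, ENNReal.ofReal ((gm^[m] α) ^ (-(1 - 1 / ((N:ℝ) + 2)))) *
        ENNReal.ofReal (((m:ℝ) + 1) ^ (-(1 / (1 - 1 / ((N:ℝ) + 2))))) < ⊤ := by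
    intro N
    apply metric_s
    · have : 1 / ((N:ℝ) + 2) < 1 := by
        rw [div_lt_one (by positivity)]; linarith [Nat.cast_nonneg (α := ℝ) N]
      linarith
    · have : 0 < 1 / ((N:ℝ) + 2) := by positivity
      linarith
  have h2 := ae_all_iff.2 h1
  have h3 := ae_mono (Measure.restrict_mono Ioo_subset_Ico_self le_rfl : volume.restrict (Ioo (0:ℝ) 1) ≤ volume.restrict (Ico (0:ℝ) 1)) h2
  filter_upwards [h3] with α hα hirr hmem r hr
  have ht : Tendsto (fun N : ℕ => 1 / (1 - 1 / ((N:ℝ) + 2)) ^ 2) atTop (nhds 1) := by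
    have e : Tendsto (fun N : ℕ => 1 / ((N:ℝ) + 2)) atTop (nhds 0) :=
      tendsto_const_nhds.div_atTop (tendsto_atTop_add_const_right _ _ tendsto_natCast_atTop_atTop)
    have := ((tendsto_const_nhds (x := (1:ℝ))).sub e).pow 2
    have := this.inv₀ (by norm_num)
    simpa using this
  obtain ⟨N, hN⟩ := (ht.eventually (gt_mem_nhds hr)).exists
  have hs1 : 1 / ((N:ℝ) + 2) < 1 := by
    rw [div_lt_one (by positivity)]; linarith [Nat.cast_nonneg (α := ℝ) N]
  have hs2 : 0 < 1 / ((N:ℝ) + 2) := by positivity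
  obtain ⟨C, hC, hk⟩ := growth_s (1 - 1 / ((N:ℝ) + 2)) (by linarith) (by linarith) α
    (fun m => (gm_irr hirr hmem m).2.1) (hα N)
  refine ⟨C, hC, fun k h => (hk k h).trans ?_⟩
  have : (1:ℝ) ≤ k := by exact_mod_cast h
  gcongr

/-- denominators and numerators of convergents, shifted by one -/
noncomputable def cfQ (α : ℝ) : ℕ → ℤ
  | 0 => 0
  | 1 => 1
  | (m + 2) => ⌊1 / gm^[m] α⌋ * cfQ α (m + 1) + cfQ α m

noncomputable def cfP (α : ℝ) : ℕ → ℤ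
  | 0 => 1
  | 1 => 0
  | (m + 2) => ⌊1 / gm^[m] α⌋ * cfP α (m + 1) + cfP α m

noncomputable def cfD (α : ℝ) : ℕ → ℝ
  | 0 => 1
  | (m + 1) => cfD α m * gm^[m] α

section cf
variable {α : ℝ}

lemma cfD_pos (h : Irrational α) (h0 : α ∈ Ioo (0:ℝ) 1) (m : ℕ) : 0 < cfD α m := by
  induction m with
  | zero => simp [cfD]
  | succ m ih => exact mul_pos ih (gm_irr h h0 m).2.1

lemma cfD_lt (h : Irrational α) (h0 : α ∈ Ioo (0:ℝ) 1) (m : ℕ) : cfD α (m + 1) < cfD α m := by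
  have h1 := cfD_pos h h0 m
  have h2 := (gm_irr h h0 m).2.2
  simp only [cfD]
  nlinarith

lemma cfa_pos (h : Irrational α) (h0 : α ∈ Ioo (0:ℝ) 1) (m : ℕ) : 1 ≤ ⌊1 / gm^[m] α⌋ := by
  have h2 := (gm_irr h h0 m).2
  rw [Int.le_floor]
  push_cast
  rw [le_div_iff₀ h2.1]
  linarith [h2.2]

lemma cfD_rec (h : Irrational α) (h0 : α ∈ Ioo (0:ℝ) 1) (m : ℕ) :
    cfD α (m + 2) = cfD α m - ⌊1 / gm^[m] α⌋ * cfD α (m + 1) := by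
  have h2 := (gm_irr h h0 m).2.1
  have : gm^[m + 1] α = 1 / gm^[m] α - ⌊1 / gm^[m] α⌋ := by
    rw [Function.iterate_succ_apply']; rfl
  simp only [cfD]
  rw [this]
  field_simp

lemma cf_theta (h : Irrational α) (h0 : α ∈ Ioo (0:ℝ) 1) (m : ℕ) :
    cfQ α m * α - cfP α m = (-1) ^ (m + 1) * cfD α m ∧
    cfQ α (m + 1) * α - cfP α (m + 1) = (-1) ^ (m + 2) * cfD α (m + 1) := by
  induction m with
  | zero => simp [cfQ, cfP, cfD]
  | succ m ih =>
    refine ⟨ih.2, ?_⟩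
    have h1 := ih.1
    have h2 := ih.2
    rw [cfD_rec h h0]
    simp only [cfQ, cfP]
    push_cast
    have e : (-1:ℝ) ^ (m + 1 + 2) = (-1) ^ (m + 1) := by ring
    have e2 : (-1:ℝ) ^ (m + 2) = - (-1) ^ (m + 1) := by ring
    rw [e]
    rw [e2] at h2
    linear_combination h1 + (⌊1 / gm^[m] α⌋ : ℝ) * h2

lemma cf_det (m : ℕ) :
    cfQ α (m + 1) * cfP α m - cfQ α m * cfP α (m + 1) = (-1) ^ m := by
  induction m with
  | zero => simp [cfQ, cfP]
  | succ m ih =>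
    simp only [cfQ, cfP]
    rw [pow_succ, ← ih]
    ring

lemma cfQ_nonneg (h : Irrational α) (h0 : α ∈ Ioo (0:ℝ) 1) (m : ℕ) :
    0 ≤ cfQ α m ∧ 1 ≤ cfQ α (m + 1) ∧ cfQ α m ≤ cfQ α (m + 1) := by
  induction m with
  | zero => simp [cfQ]
  | succ m ih =>
    have := cfa_pos h h0 m
    have e : cfQ α (m + 1 + 1) = ⌊1 / gm^[m] α⌋ * cfQ α (m + 1) + cfQ α m := by simp only [cfQ]
    have : cfQ α (m + 1) ≤ cfQ α (m + 1 + 1) := by rw [e]; nlinarith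
    exact ⟨by omega, by omega, this⟩

lemma cfQ_grow (h : Irrational α) (h0 : α ∈ Ioo (0:ℝ) 1) (m : ℕ) :
    cfQ α (m + 2) ≥ cfQ α (m + 1) + cfQ α m := by
  have := cfa_pos h h0 m
  have h1 := (cfQ_nonneg h h0 m).2.1
  have e : cfQ α (m + 2) = ⌊1 / gm^[m] α⌋ * cfQ α (m + 1) + cfQ α m := by simp only [cfQ]
  rw [e]; nlinarith

lemma cfQ_mono (h : Irrational α) (h0 : α ∈ Ioo (0:ℝ) 1) : Monotone (cfQ α) :=
  monotone_nat_of_le_succ fun m => (cfQ_nonneg h h0 m).2.2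

lemma cfQ_large (h : Irrational α) (h0 : α ∈ Ioo (0:ℝ) 1) (m : ℕ) : (m:ℤ) + 1 ≤ cfQ α (m + 2) := by
  induction m with
  | zero => have := (cfQ_nonneg h h0 1).2.1; simpa using this
  | succ m ih =>
    have := cfQ_grow h h0 (m + 1)
    have := (cfQ_nonneg h h0 m).2.1
    push_cast
    have e : cfQ α (m + 1 + 2) ≥ cfQ α (m + 2) + cfQ α (m + 1) := by assumption
    omega

/-- best approximation -/
lemma cf_best (h : Irrational α) (h0 : α ∈ Ioo (0:ℝ) 1) (m : ℕ) (k p : ℤ) (hk : 1 ≤ k)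
    (hk2 : k < cfQ α (m + 1)) : cfD α m ≤ |k * α - p| := by
  have hdet := cf_det (α := α) m
  obtain ⟨t1, t2⟩ := cf_theta h h0 m
  have hD := cfD_pos h h0 m
  have hD1 := cfD_pos h h0 (m + 1)
  have hQ := cfQ_nonneg h h0 m
  set e : ℤ := (-1) ^ m with he
  have hee : e * e = 1 := by rw [he, ← pow_add, ← two_mul, pow_mul]; simp
  set u : ℤ := e * (cfQ α (m + 1) * p - cfP α (m + 1) * k) with hu
  set v : ℤ := e * (cfP α m * k - cfQ α m * p) with hv
  have hku : k = u * cfQ α m + v * cfQ α (m + 1) := by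
    have : u * cfQ α m + v * cfQ α (m + 1) = e * (cfQ α (m + 1) * cfP α m - cfQ α m * cfP α (m + 1)) * k := by
      rw [hu, hv]; ring
    rw [this, hdet, hee, one_mul]
  have hpu : p = u * cfP α m + v * cfP α (m + 1) := by
    have : u * cfP α m + v * cfP α (m + 1) = e * (cfQ α (m + 1) * cfP α m - cfQ α m * cfP α (m + 1)) * p := by
      rw [hu, hv]; ring
    rw [this, hdet, hee, one_mul]
  have hval : (k:ℝ) * α - p = (-1) ^ (m + 1) * (u * cfD α m - v * cfD α (m + 1)) := by
    have e1 : (k:ℝ) = u * cfQ α m + v * cfQ α (m + 1) := by exact_mod_cast hku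
    have e2 : (p:ℝ) = u * cfP α m + v * cfP α (m + 1) := by exact_mod_cast hpu
    rw [e1, e2]
    linear_combination (u:ℝ) * t1 + (v:ℝ) * t2
  rw [hval, abs_mul, abs_pow, abs_neg, abs_one, one_pow, one_mul]
  have hune : u ≠ 0 := by
    intro h0
    rw [h0, zero_mul, zero_add] at hku
    have : 1 ≤ v := by by_contra hc; nlinarith
    nlinarith
  rcases lt_or_gt_of_ne hune with hneg | hpos
  · have hv0 : 0 ≤ v := by by_contra hc; nlinarith
    have a1 : (u:ℝ) ≤ -1 := by exact_mod_cast (by omega : u ≤ -1)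
    have a2 : (0:ℝ) ≤ v := by exact_mod_cast hv0
    rw [le_abs]; right; nlinarith
  · have hv0 : v ≤ 0 := by by_contra hc; nlinarith
    have a1 : (1:ℝ) ≤ u := by exact_mod_cast (by omega : 1 ≤ u)
    have a2 : (v:ℝ) ≤ 0 := by exact_mod_cast hv0
    rw [le_abs]; left; nlinarith

/-- two orbit points -/
lemma gap_min (h : Irrational α) (h0 : α ∈ Ioo (0:ℝ) 1) (m : ℕ) (M : ℕ) (hM : (M:ℤ) < cfQ α (m + 1))
    (i i' : ℕ) (hi : i ≤ M) (hi' : i' ≤ M) (d : ℝ) (hd : 0 < d) (z : ℤ)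
    (hz : d = ((i:ℝ) - i') * α + z) : cfD α m ≤ d := by
  have hD1 : cfD α m ≤ 1 := by
    clear hM
    induction m with
    | zero => simp [cfD]
    | succ m ih => exact (cfD_lt h h0 m).le.trans ih
  rcases lt_trichotomy i i' with hlt | heq | hgt
  · have := cf_best h h0 m ((i':ℤ) - i) z (by omega) (by omega)
    push_cast at this
    rw [abs_of_neg (by rw [hz] at hd; linarith)] at this
    rw [hz]; linarith
  · subst heq
    simp at hz
    have : 1 ≤ z := by
      have : (0:ℝ) < z := hz ▸ hd
      exact_mod_cast this
    rw [hz]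
    exact hD1.trans (by exact_mod_cast this)
  · have := cf_best h h0 m ((i:ℤ) - i') (-z) (by omega) (by omega)
    push_cast at this
    rw [abs_of_pos (by rw [hz] at hd; linarith)] at this
    rw [hz]; linarith

lemma gap_max (h : Irrational α) (h0 : α ∈ Ioo (0:ℝ) 1) (m : ℕ) (M : ℕ)
    (hM : cfQ α (m + 1) ≤ (M:ℤ) + 1) (i : ℕ) (hi : i ≤ M) :
    ∃ i' ≤ M, ∃ z : ℤ, 0 < ((i:ℝ) - i') * α + z ∧
      ((i:ℝ) - i') * α + z ≤ cfD α m + cfD α (m + 1) := by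
  obtain ⟨t1, t2⟩ := cf_theta h h0 m
  have hD := cfD_pos h h0 m
  have hD1 := cfD_pos h h0 (m + 1)
  obtain ⟨q0, q1, q01⟩ := cfQ_nonneg h h0 m
  rcases Nat.even_or_odd m with he | ho
  · have s1 : (-1:ℝ) ^ (m + 1) = -1 := (he.add_one).neg_one_pow
    have s2 : (-1:ℝ) ^ (m + 2) = 1 := by rw [pow_add, he.neg_one_pow]; norm_num
    rw [s1] at t1; rw [s2] at t2
    by_cases hc : (i:ℤ) + cfQ α m ≤ M
    · refine ⟨((i:ℤ) + cfQ α m).toNat, by omega, cfP α m, ?_⟩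
      have e : (((i:ℤ) + cfQ α m).toNat : ℝ) = (i:ℝ) + cfQ α m := by
        exact_mod_cast congrArg (Int.cast (R := ℝ)) (Int.toNat_of_nonneg (by omega : 0 ≤ (i:ℤ) + cfQ α m))
      rw [e]
      constructor <;> linarith
    · refine ⟨((i:ℤ) + cfQ α m - cfQ α (m + 1)).toNat, by omega, cfP α m - cfP α (m + 1), ?_⟩
      have e : (((i:ℤ) + cfQ α m - cfQ α (m + 1)).toNat : ℝ) = (i:ℝ) + cfQ α m - cfQ α (m + 1) := by
        exact_mod_cast congrArg (Int.cast (R := ℝ)) (Int.toNat_of_nonneg (by omega : 0 ≤ (i:ℤ) + cfQ α m - cfQ α (m + 1)))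
      rw [e]
      push_cast
      constructor <;> linarith
  · have s1 : (-1:ℝ) ^ (m + 1) = 1 := (ho.add_one).neg_one_pow
    have s2 : (-1:ℝ) ^ (m + 2) = -1 := by rw [pow_add, ho.neg_one_pow]; norm_num
    rw [s1] at t1; rw [s2] at t2
    by_cases hc : cfQ α m ≤ i
    · refine ⟨((i:ℤ) - cfQ α m).toNat, by omega, - cfP α m, ?_⟩
      have e : (((i:ℤ) - cfQ α m).toNat : ℝ) = (i:ℝ) - cfQ α m := by
        exact_mod_cast congrArg (Int.cast (R := ℝ)) (Int.toNat_of_nonneg (by omega : 0 ≤ (i:ℤ) - cfQ α m))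
      rw [e]
      push_cast
      constructor <;> linarith
    · refine ⟨((i:ℤ) - cfQ α m + cfQ α (m + 1)).toNat, by omega, - cfP α m + cfP α (m + 1), ?_⟩
      have e : (((i:ℤ) - cfQ α m + cfQ α (m + 1)).toNat : ℝ) = (i:ℝ) - cfQ α m + cfQ α (m + 1) := by
        exact_mod_cast congrArg (Int.cast (R := ℝ)) (Int.toNat_of_nonneg (by omega : 0 ≤ (i:ℤ) - cfQ α m + cfQ α (m + 1)))
      rw [e]
      push_cast
      constructor <;> linarith

end cf

noncomputable def pt (α : ℝ) (i : ℕ) : ℝ := Int.fract ((1 - (i:ℝ)) * α)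

def atom (α x : ℝ) (j : ℕ) : Set ℝ :=
  {y ∈ Ico (0:ℝ) 1 | ∀ i ≤ j, code α y i = code α x i}

section atoms
variable {α : ℝ}

lemma rot_iter (x : ℝ) (hx : x ∈ Ico (0:ℝ) 1) (i : ℕ) :
    (rot α)^[i] x = Int.fract (x + i * α) := by
  induction i with
  | zero => simp [Int.fract_eq_self.2 ⟨hx.1, hx.2⟩]
  | succ i ih =>
    rw [Function.iterate_succ_apply', ih]
    unfold rot
    rw [Int.fract_eq_fract]
    refine ⟨-⌊x + i * α⌋, ?_⟩
    have := Int.floor_add_fract (x + i * α)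
    push_cast
    linarith

lemma code_cond (h0 : α ∈ Ioo (0:ℝ) 1) (y : ℝ) (hy : y ∈ Ico (0:ℝ) 1) (j : ℕ) :
    (rot α)^[j + 1] y < α ↔
      (pt α (j + 2) ≤ y ∧ y < pt α (j + 2) + α) ∨ (y < pt α (j + 2) + α - 1) := by
  rw [rot_iter y hy]
  set p := pt α (j + 2) with hp
  have hp0 : 0 ≤ p := Int.fract_nonneg _
  have hp1 : p < 1 := Int.fract_lt_one _
  obtain ⟨z, hz⟩ : ∃ z : ℤ, p = -((j:ℝ) + 1) * α + z := by
    refine ⟨-⌊(1 - ((j + 2 : ℕ):ℝ)) * α⌋, ?_⟩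
    have := Int.floor_add_fract ((1 - ((j + 2 : ℕ):ℝ)) * α)
    rw [hp, pt]
    push_cast at *
    linarith
  by_cases hc : p ≤ y
  · have : Int.fract (y + ((j + 1 : ℕ):ℝ) * α) = y - p := by
      rw [Int.fract_eq_iff]
      refine ⟨by linarith, by linarith [hy.2], z, ?_⟩
      push_cast; linarith
    rw [this]
    constructor
    · intro h; left; exact ⟨hc, by linarith⟩
    · rintro (h | h)
      · linarith
      · linarith [h0.2]
  · push Not at hc
    have : Int.fract (y + ((j + 1 : ℕ):ℝ) * α) = y - p + 1 := by
      rw [Int.fract_eq_iff]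
      refine ⟨by linarith [hy.1], by linarith, z - 1, ?_⟩
      push_cast; linarith
    rw [this]
    constructor
    · intro h; right; linarith
    · rintro (h | h)
      · linarith
      · linarith

lemma pt_succ (h0 : α ∈ Ioo (0:ℝ) 1) (j : ℕ) :
    (pt α (j + 2) + α < 1 ∧ pt α (j + 1) = pt α (j + 2) + α) ∨
    (1 ≤ pt α (j + 2) + α ∧ pt α (j + 1) = pt α (j + 2) + α - 1) := by
  set p := pt α (j + 2) with hp
  have hp0 : 0 ≤ p := Int.fract_nonneg _
  have hp1 : p < 1 := Int.fract_lt_one _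
  obtain ⟨z, hz⟩ : ∃ z : ℤ, p = -((j:ℝ) + 1) * α + z := by
    refine ⟨-⌊(1 - ((j + 2 : ℕ):ℝ)) * α⌋, ?_⟩
    have := Int.floor_add_fract ((1 - ((j + 2 : ℕ):ℝ)) * α)
    rw [hp, pt]
    push_cast at *
    linarith
  by_cases hc : p + α < 1
  · left
    refine ⟨hc, ?_⟩
    rw [pt, Int.fract_eq_iff]
    refine ⟨by linarith [h0.1], hc, -z, ?_⟩
    push_cast; linarith
  · right
    push Not at hc
    refine ⟨hc, ?_⟩
    rw [pt, Int.fract_eq_iff]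
    refine ⟨by linarith [h0.1], by linarith [h0.2], -z + 1, ?_⟩
    push_cast; linarith

lemma code_eq_iff (x y : ℝ) (i : ℕ) :
    code α y i = code α x i ↔ ((rot α)^[i] y < α ↔ (rot α)^[i] x < α) := by
  unfold code
  by_cases h1 : (rot α)^[i] y < α <;> by_cases h2 : (rot α)^[i] x < α <;> simp [h1, h2]

lemma atom_succ (x : ℝ) (j : ℕ) :
    atom α x (j + 1) = {y ∈ atom α x j | code α y (j + 1) = code α x (j + 1)} := by
  ext y
  simp only [atom, mem_ofPred_eq]
  constructor
  · rintro ⟨h1, h2⟩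
    exact ⟨⟨h1, fun i hi => h2 i (by omega)⟩, h2 _ le_rfl⟩
  · rintro ⟨⟨h1, h2⟩, h3⟩
    refine ⟨h1, fun i hi => ?_⟩
    rcases Nat.lt_or_ge i (j + 1) with h | h
    · exact h2 i (by omega)
    · have : i = j + 1 := by omega
      rw [this]; exact h3

lemma atom_interval (h0 : α ∈ Ioo (0:ℝ) 1) (x : ℝ) (hx : x ∈ Ico (0:ℝ) 1) (j : ℕ) :
    ∃ a b, atom α x j = Ico a b ∧ x ∈ Ico a b ∧ 0 ≤ a ∧ b ≤ 1 ∧ (∃ i ≤ j + 1, a = pt α i) ∧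
      (∃ i ≤ j + 1, ∃ z : ℤ, b = pt α i + z) ∧ ∀ i ≤ j + 1, pt α i ∉ Ioo a b := by
  have p0 : pt α 0 = α := by
    simp only [pt, Nat.cast_zero, sub_zero, one_mul]
    exact Int.fract_eq_self.2 ⟨h0.1.le, h0.2⟩
  have p1 : pt α 1 = 0 := by simp [pt]
  have hI : ∀ i ≤ 0 + 1, i = 0 ∨ i = 1 := fun i hi => by omega
  induction j with
  | zero =>
    by_cases hc : x < α
    · refine ⟨0, α, ?_, ⟨hx.1, hc⟩, le_rfl, h0.2.le, ⟨1, by simp, p1.symm⟩,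
        ⟨0, by simp, 0, by simp [p0]⟩, ?_⟩
      · ext y
        simp only [atom, mem_ofPred_eq, Nat.le_zero, forall_eq, code_eq_iff,
          Function.iterate_zero, id, mem_Ico]
        constructor
        · rintro ⟨h1, h2⟩; exact ⟨h1.1, h2.2 hc⟩
        · rintro ⟨h1, h2⟩; exact ⟨⟨h1, h2.trans h0.2⟩, by simp [h2, hc]⟩
      · intro i hi
        rcases hI i hi with rfl | rfl
        · rw [p0]; simp
        · rw [p1]; simp
    · have hc' := not_lt.1 hc
      refine ⟨α, 1, ?_, ⟨hc', hx.2⟩, h0.1.le, le_rfl, ⟨0, by simp, p0.symm⟩,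
        ⟨1, by simp, 1, by simp [p1]⟩, ?_⟩
      · ext y
        simp only [atom, mem_ofPred_eq, Nat.le_zero, forall_eq, code_eq_iff,
          Function.iterate_zero, id, mem_Ico]
        constructor
        · rintro ⟨h1, h2⟩; exact ⟨not_lt.1 fun h => hc (h2.1 h), h1.2⟩
        · rintro ⟨h1, h2⟩; exact ⟨⟨h0.1.le.trans h1, h2⟩, iff_of_false (not_lt.2 h1) hc⟩
      · intro i hi
        rcases hI i hi with rfl | rfl
        · rw [p0]; simp
        · rw [p1]; simp [h0.1.le]
  | succ j ih =>
    obtain ⟨a, b, hA, hxab, ha0, hb1, ⟨ia, hia, hia'⟩, ⟨ib, hib, zb, hzb⟩, hno⟩ := ih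
    have hsub : ∀ y ∈ Ico a b, y ∈ Ico (0:ℝ) 1 := fun y hy => ⟨ha0.trans hy.1, hy.2.trans_le hb1⟩
    have hp' := hno (j + 1) le_rfl
    have hps := pt_succ h0 j
    have hcc := fun y hy => code_cond h0 y (hsub y hy) j
    have hp0 : 0 ≤ pt α (j + 2) := Int.fract_nonneg _
    have hp1 : pt α (j + 2) < 1 := Int.fract_lt_one _
    have hα0 := h0.1
    have hα1 := h0.2
    have hab : a < b := hxab.1.trans_lt hxab.2
    rw [atom_succ, hA]
    simp only [code_eq_iff]
    set p := pt α (j + 2) with hp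
    set p' := pt α (j + 1)
    have hp'' : p' ≤ a ∨ b ≤ p' := by
      by_contra hc
      push Not at hc
      exact hp' hc
    by_cases hin : p ∈ Ioo a b
    · have hcond : ∀ y ∈ Ico a b, ((rot α)^[j + 1] y < α ↔ p ≤ y) := by
        intro y hy
        rw [hcc y hy]
        obtain ⟨hy1, hy2⟩ := hy
        obtain ⟨hi1, hi2⟩ := hin
        rcases hps with ⟨e1, e2⟩ | ⟨e1, e2⟩ <;> rcases hp'' with e3 | e3
        · constructor
          · rintro (h | h) <;> linarith
          · intro h; linarith
        · constructor
          · rintro (h | h) <;> linarith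
          · intro h; left; constructor <;> linarith
        · constructor
          · rintro (h | h) <;> linarith
          · intro h; left; constructor <;> linarith
        · linarith
      by_cases hxp : p ≤ x
      · refine ⟨p, b, ?_, ⟨hxp, hxab.2⟩, hp0, hb1, ⟨j + 2, le_rfl, rfl⟩,
          ⟨ib, by omega, zb, hzb⟩, ?_⟩
        · ext y
          simp only [mem_ofPred_eq]
          constructor
          · rintro ⟨h1, h2⟩
            rw [hcond y h1, hcond x hxab] at h2
            exact ⟨h2.2 hxp, h1.2⟩
          · rintro ⟨h1, h2⟩
            have h3 : y ∈ Ico a b := ⟨hin.1.le.trans h1, h2⟩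
            rw [hcond y h3, hcond x hxab]
            exact ⟨h3, by simp [h1, hxp]⟩
        · intro i hi hmem
          rcases Nat.lt_or_ge i (j + 2) with h | h
          · exact hno i (by omega) ⟨hin.1.trans hmem.1, hmem.2⟩
          · have : i = j + 2 := by omega
            rw [this] at hmem
            exact lt_irrefl _ hmem.1
      · refine ⟨a, p, ?_, ⟨hxab.1, not_le.1 hxp⟩, ha0, hp1.le, ⟨ia, by omega, hia'⟩,
          ⟨j + 2, le_rfl, 0, by simp [hp]⟩, ?_⟩
        · ext y
          simp only [mem_ofPred_eq]
          constructor
          · rintro ⟨h1, h2⟩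
            rw [hcond y h1, hcond x hxab] at h2
            exact ⟨h1.1, not_le.1 fun h => hxp (h2.1 h)⟩
          · rintro ⟨h1, h2⟩
            have h3 : y ∈ Ico a b := ⟨h1, h2.trans hin.2⟩
            rw [hcond y h3, hcond x hxab]
            exact ⟨h3, iff_of_false (not_le.2 h2) hxp⟩
        · intro i hi hmem
          rcases Nat.lt_or_ge i (j + 2) with h | h
          · exact hno i (by omega) ⟨hmem.1, hmem.2.trans hin.2⟩
          · have : i = j + 2 := by omega
            rw [this] at hmem
            exact lt_irrefl _ hmem.2
    · have hin' : p ≤ a ∨ b ≤ p := by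
        by_contra hc
        push Not at hc
        exact hin hc
      have hcond : ∀ y ∈ Ico a b, ∀ y' ∈ Ico a b,
          (rot α)^[j + 1] y < α → (rot α)^[j + 1] y' < α := by
        intro y hy y' hy'
        rw [hcc y hy, hcc y' hy']
        obtain ⟨hy1, hy2⟩ := hy
        obtain ⟨hy1', hy2'⟩ := hy'
        rcases hps with ⟨e1, e2⟩ | ⟨e1, e2⟩ <;> rcases hp'' with e3 | e3 <;> rcases hin' with e4 | e4 <;>
        rintro (h | h) <;>
        first
          | linarith
          | (left; constructor <;> linarith)
          | (right; linarith)
      refine ⟨a, b, ?_, hxab, ha0, hb1, ⟨ia, by omega, hia'⟩, ⟨ib, by omega, zb, hzb⟩, ?_⟩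
      · ext y
        simp only [mem_ofPred_eq]
        exact ⟨fun h => h.1, fun h => ⟨h, hcond y h x hxab, hcond x hxab y h⟩⟩
      · intro i hi hmem
        rcases Nat.lt_or_ge i (j + 2) with h | h
        · exact hno i (by omega) hmem
        · have : i = j + 2 := by omega
          rw [this] at hmem
          exact hin hmem

noncomputable def len (α x : ℝ) (j : ℕ) : ℝ := (volume (atom α x j)).toReal

lemma len_lower (h : Irrational α) (h0 : α ∈ Ioo (0:ℝ) 1) (x : ℝ) (hx : x ∈ Ico (0:ℝ) 1) (j m : ℕ)
    (hm : (j:ℤ) + 1 < cfQ α (m + 1)) : cfD α m ≤ len α x j := by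
  obtain ⟨a, b, hA, hxab, ha0, hb1, ⟨ia, hia, hia'⟩, ⟨ib, hib, zb, hzb⟩, hno⟩ :=
    atom_interval h0 x hx j
  have hab : a < b := hxab.1.trans_lt hxab.2
  rw [len, hA, Real.volume_Ico, ENNReal.toReal_ofReal (by linarith)]
  refine gap_min h h0 m (j + 1) (by push_cast; exact hm) ia ib hia hib (b - a) (by linarith)
    (zb - ⌊(1 - (ib:ℝ)) * α⌋ + ⌊(1 - (ia:ℝ)) * α⌋) ?_
  rw [hia', hzb, pt, pt, Int.fract, Int.fract]
  push_cast
  ring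

lemma len_upper (h : Irrational α) (h0 : α ∈ Ioo (0:ℝ) 1) (x : ℝ) (hx : x ∈ Ico (0:ℝ) 1) (j m : ℕ)
    (hm : cfQ α (m + 1) ≤ (j:ℤ) + 2) : len α x j ≤ cfD α m + cfD α (m + 1) := by
  obtain ⟨a, b, hA, hxab, ha0, hb1, ⟨ia, hia, hia'⟩, ⟨ib, hib, zb, hzb⟩, hno⟩ :=
    atom_interval h0 x hx j
  have hab : a < b := hxab.1.trans_lt hxab.2
  rw [len, hA, Real.volume_Ico, ENNReal.toReal_ofReal (by linarith)]
  obtain ⟨i', hi', z, hz0, hz1⟩ := gap_max h h0 m (j + 1) (by push_cast; linarith) ia hia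
  refine le_trans ?_ hz1
  by_contra hc
  push Not at hc
  refine hno i' hi' ?_
  have : pt α i' = a + (((ia:ℝ) - i') * α + z) := by
    rw [pt, Int.fract_eq_iff]
    refine ⟨by linarith, by linarith, ⌊(1 - (ia:ℝ)) * α⌋ - z, ?_⟩
    rw [hia', pt, Int.fract]
    push_cast
    ring
  rw [this]
  constructor <;> linarith

lemma undet_mem {x : ℝ} {j : ℕ} (hx : x ∈ Ico (0:ℝ) 1) :
    x ∈ undet α j ↔ ∃ y ∈ atom α x j, code α y (j + 1) ≠ code α x (j + 1) := by
  simp only [undet, atom, mem_ofPred_eq]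
  constructor
  · rintro ⟨_, y, h1, h2, h3⟩; exact ⟨y, ⟨h1, h2⟩, h3⟩
  · rintro ⟨y, ⟨h1, h2⟩, h3⟩; exact ⟨hx, y, h1, h2, h3⟩

lemma len_stay {x : ℝ} {j : ℕ} (hx : x ∈ Ico (0:ℝ) 1) (hn : x ∉ undet α j) :
    len α x (j + 1) = len α x j := by
  rw [undet_mem hx] at hn
  push Not at hn
  have : atom α x (j + 1) = atom α x j := by
    rw [atom_succ]
    ext y
    exact ⟨fun h => h.1, fun h => ⟨h, hn y h⟩⟩
  rw [len, this, len]

lemma len_drop (h : Irrational α) (h0 : α ∈ Ioo (0:ℝ) 1) {x : ℝ} {j : ℕ} (m : ℕ)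
    (hx : x ∈ Ico (0:ℝ) 1) (hn : x ∈ undet α j) (hm : (j:ℤ) + 2 < cfQ α (m + 1)) :
    len α x (j + 1) + cfD α m ≤ len α x j := by
  rw [undet_mem hx] at hn
  obtain ⟨y, hy, hyc⟩ := hn
  have hl := len_lower h h0 y hy.1 (j + 1) m (by push_cast; linarith)
  have hmeas : ∀ x ∈ Ico (0:ℝ) 1, ∀ j, MeasurableSet (atom α x j) ∧ volume (atom α x j) ≠ ⊤ := by
    intro x hx j
    obtain ⟨a, b, hA, -⟩ := atom_interval h0 x hx j
    rw [hA]
    exact ⟨measurableSet_Ico, by simp⟩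
  have hsub : atom α x (j + 1) ∪ atom α y (j + 1) ⊆ atom α x j := by
    rw [atom_succ, atom_succ]
    rintro z (hz | hz)
    · exact hz.1
    · exact ⟨hz.1.1, fun i hi => (hz.1.2 i hi).trans (hy.2 i hi)⟩
  have hdisj : Disjoint (atom α x (j + 1)) (atom α y (j + 1)) := by
    rw [Set.disjoint_left]
    intro z hz hz'
    exact hyc ((hz'.2 _ le_rfl).symm.trans (hz.2 _ le_rfl))
  have h1 := measure_mono (μ := volume) hsub
  rw [measure_union hdisj (hmeas y hy.1 _).1] at h1
  have h2 := ENNReal.toReal_mono (hmeas x hx j).2 h1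
  rw [ENNReal.toReal_add (hmeas x hx _).2 (hmeas y hy.1 _).2] at h2
  unfold len at *
  linarith

/-- number of splits before time `t` -/
noncomputable def cnt (α x : ℝ) (t : ℕ) : ℝ :=
  ∑ j ∈ Finset.range t, Set.indicator (undet α j) (fun _ => (1:ℝ)) x

lemma cnt_step (x : ℝ) (t : ℕ) : cnt α x (t + 1) = cnt α x t + Set.indicator (undet α t) (fun _ => (1:ℝ)) x := by
  unfold cnt
  rw [Finset.sum_range_succ]

lemma cnt_mono (x : ℝ) : Monotone (cnt α x) := by
  refine monotone_nat_of_le_succ fun t => ?_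
  rw [cnt_step]
  have := Set.indicator_nonneg (s := undet α t) (f := fun _ => (1:ℝ)) (fun _ _ => zero_le_one) x
  linarith

lemma cnt_block (h : Irrational α) (h0 : α ∈ Ioo (0:ℝ) 1) {x : ℝ} (hx : x ∈ Ico (0:ℝ) 1) (m s d : ℕ)
    (hm : (s:ℤ) + d + 1 < cfQ α (m + 1)) :
    (cnt α x (s + d) - cnt α x s) * cfD α m + len α x (s + d) ≤ len α x s := by
  induction d with
  | zero => simp
  | succ d ih =>
    have ih' := ih (by push_cast at hm; linarith)
    rw [← add_assoc, cnt_step]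
    by_cases hu : x ∈ undet α (s + d)
    · have := len_drop h h0 m hx hu (by push_cast at *; linarith)
      rw [Set.indicator_of_mem hu]
      linarith
    · rw [Set.indicator_of_notMem hu, len_stay hx hu]
      linarith

lemma cnt_const {x : ℝ} (hx : x ∈ Ico (0:ℝ) 1) (s d : ℕ)
    (hc : cnt α x (s + d) < cnt α x s + 1) : len α x (s + d) = len α x s := by
  induction d with
  | zero => simp
  | succ d ih =>
    rw [← add_assoc, cnt_step] at hc
    have hmono := cnt_mono (α := α) x (Nat.le_add_right s d)
    by_cases hu : x ∈ undet α (s + d)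
    · rw [Set.indicator_of_mem hu] at hc
      linarith
    · rw [Set.indicator_of_notMem hu, add_zero] at hc
      rw [← add_assoc, len_stay hx hu, ih hc]

/-- block end times -/
noncomputable def tm (α : ℝ) (m : ℕ) : ℕ := (cfQ α m - 2).toNat

lemma tm_mono (h : Irrational α) (h0 : α ∈ Ioo (0:ℝ) 1) : Monotone (tm α) := by
  intro a b hab
  have := cfQ_mono h h0 hab
  unfold tm
  omega

lemma cnt_upper (h : Irrational α) (h0 : α ∈ Ioo (0:ℝ) 1) {x : ℝ} (hx : x ∈ Ico (0:ℝ) 1) (k : ℕ) :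
    cnt α x (tm α (k + 1)) ≤ ∑ m ∈ Finset.range k, 2 * (1 / gm^[m] α) := by
  induction k with
  | zero => simp [tm, cfQ, cnt]
  | succ k ih =>
    rw [Finset.sum_range_succ]
    have hg := (gm_irr h h0 k).2
    have hge : 1 ≤ 1 / gm^[k] α := by rw [le_div_iff₀ hg.1]; linarith [hg.2]
    obtain ⟨d, hd⟩ := Nat.exists_eq_add_of_le (tm_mono h h0 (Nat.le_succ (k + 1)))
    rw [Nat.succ_eq_add_one] at hd
    by_cases hd0 : d = 0
    · rw [hd0, add_zero] at hd
      rw [hd]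
      linarith
    have hQ : (tm α (k + 1) : ℤ) + d + 1 < cfQ α (k + 1 + 1) := by
      have : (tm α (k + 1 + 1) : ℤ) = tm α (k + 1) + d := by exact_mod_cast hd
      unfold tm at *
      omega
    have h1 := cnt_block h h0 hx (k + 1) _ _ hQ
    rw [← hd] at h1
    have h2 := len_upper h h0 x hx (tm α (k + 1)) k (by unfold tm; omega)
    have h3 : 0 ≤ len α x (tm α (k + 1 + 1)) := ENNReal.toReal_nonneg
    have hD := cfD_pos h h0 (k + 1)
    have e : cfD α k = (1 / gm^[k] α) * cfD α (k + 1) := by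
      have := hg.1
      simp only [cfD]
      field_simp
    have h4 : (cnt α x (tm α (k + 1 + 1)) - cnt α x (tm α (k + 1))) * cfD α (k + 1)
        ≤ (1 / gm^[k] α + 1) * cfD α (k + 1) := by linarith
    have h5 := le_of_mul_le_mul_right h4 hD
    linarith

lemma cnt_lower_step (h : Irrational α) (h0 : α ∈ Ioo (0:ℝ) 1) {x : ℝ} (hx : x ∈ Ico (0:ℝ) 1) (m : ℕ)
    (hm : 2 ≤ cfQ α (m + 1)) :
    cnt α x (tm α (m + 1)) + 1 ≤ cnt α x (tm α (m + 3)) := by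
  by_contra hc
  push Not at hc
  obtain ⟨d, hd⟩ := Nat.exists_eq_add_of_le (tm_mono h h0 (show m + 1 ≤ m + 3 by omega))
  rw [hd] at hc
  have h1 := cnt_const hx _ _ hc
  rw [← hd] at h1
  have h2 := len_lower h h0 x hx (tm α (m + 1)) m (by unfold tm; omega)
  have h3 := len_upper h h0 x hx (tm α (m + 3)) (m + 2) (by
    have e : cfQ α (m + 2 + 1) = cfQ α (m + 3) := rfl
    unfold tm; omega)
  have h4 := cfD_rec h h0 (m + 1)
  have h5 : (1:ℝ) ≤ (⌊1 / gm^[m + 1] α⌋ : ℝ) := by exact_mod_cast cfa_pos h h0 (m + 1)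
  have h6 := cfD_pos h h0 (m + 2)
  have h7 := cfD_lt h h0 m
  have e1 : cfD α (m + 1 + 2) = cfD α (m + 2 + 1) := rfl
  have e2 : cfD α (m + 1 + 1) = cfD α (m + 2) := rfl
  rw [e1, e2] at h4
  nlinarith

lemma cnt_lower (h : Irrational α) (h0 : α ∈ Ioo (0:ℝ) 1) {x : ℝ} (hx : x ∈ Ico (0:ℝ) 1) (k : ℕ) :
    ((k:ℝ) - 4) / 2 ≤ cnt α x (tm α k) := by
  have hnn : ∀ t, 0 ≤ cnt α x t := fun t =>
    Finset.sum_nonneg fun j _ => Set.indicator_nonneg (fun _ _ => zero_le_one) x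
  induction k using Nat.strong_induction_on with
  | _ k ih =>
    rcases Nat.lt_or_ge k 5 with hk | hk
    · refine le_trans ?_ (hnn _)
      have : (k:ℝ) ≤ 4 := by exact_mod_cast (by omega : k ≤ 4)
      linarith
    · obtain ⟨m, rfl⟩ : ∃ m, k = m + 1 + 1 + 3 := ⟨k - 5, by omega⟩
      have h1 := ih (m + 1 + 1 + 1) (by omega)
      have h2 := cnt_lower_step h h0 hx (m + 1 + 1) (by
        have := cfQ_large h h0 (m + 1)
        push_cast at this
        have e : cfQ α (m + 1 + 1 + 1) = cfQ α (m + 1 + 2) := rfl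
        omega)
      push_cast at *
      linarith

end atoms

lemma rot_meas (α : ℝ) : Measurable (rot α) := by
  unfold rot
  exact measurable_fract.comp (measurable_id.add_const α)

lemma code_meas (α : ℝ) (i : ℕ) : Measurable (fun x => code α x i) := by
  unfold code
  exact Measurable.ite (measurableSet_lt ((rot_meas α).iterate i) measurable_const)
    measurable_const measurable_const

lemma undet_meas (α : ℝ) (j : ℕ) : MeasurableSet (undet α j) := by
  have hF : Measurable (fun x : ℝ => fun i : Fin (j + 2) => code α x i) :=
    measurable_pi_lambda _ fun i => code_meas α i
  have : undet α j = Ico (0:ℝ) 1 ∩ (fun x : ℝ => fun i : Fin (j + 2) => code α x i) ⁻¹'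
      {g | ∃ y ∈ Ico (0:ℝ) 1, (∀ i : Fin (j + 2), (i:ℕ) ≤ j → code α y i = g i) ∧
        code α y (j + 1) ≠ g ⟨j + 1, by omega⟩} := by
    ext x
    simp only [undet, mem_ofPred_eq, mem_inter_iff, mem_preimage]
    refine and_congr_right fun _ => exists_congr fun y => and_congr_right fun _ =>
      and_congr_left fun _ => ?_
    exact ⟨fun h i hi => h i hi, fun h i hi => h ⟨i, by omega⟩ hi⟩
  rw [this]
  exact measurableSet_Ico.inter (hF (Set.to_countable _).measurableSet)

lemma sum_eq_cnt (α x : ℝ) (n : ℕ) :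
    ∑ j ∈ Finset.Icc 1 n, Set.indicator (undet α j) (fun _ => (1:ℝ)) x
      = cnt α x (n + 1) - Set.indicator (undet α 0) (fun _ => (1:ℝ)) x := by
  induction n with
  | zero => simp [cnt]
  | succ n ih =>
    rw [Finset.sum_Icc_succ_top (by omega), ih, cnt_step x (n + 1)]
    ring

lemma both_bounds {α : ℝ} (h : Irrational α) (h0 : α ∈ Ioo (0:ℝ) 1) :
    ∃ κ : ℕ → ℕ, Tendsto κ atTop atTop ∧ ∀ n, ∀ x ∈ Ico (0:ℝ) 1,
      ((κ n : ℝ) - 6) / 2 ≤ ∑ j ∈ Finset.Icc 1 n, Set.indicator (undet α j) (fun _ => (1:ℝ)) x ∧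
      ∑ j ∈ Finset.Icc 1 n, Set.indicator (undet α j) (fun _ => (1:ℝ)) x
        ≤ ∑ m ∈ Finset.range (κ n), 2 * (1 / gm^[m] α) := by
  have hex : ∀ n : ℕ, ∃ k, cfQ α k ≤ (n:ℤ) + 3 ∧ (n:ℤ) + 3 < cfQ α (k + 1) := by
    intro n
    classical
    have hE : ∃ k, (n:ℤ) + 3 < cfQ α (k + 1) :=
      ⟨n + 4, by have := cfQ_large h h0 (n + 3); push_cast at this; exact lt_of_lt_of_le (by omega) this⟩
    refine ⟨Nat.find hE, ?_, Nat.find_spec hE⟩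
    rcases Nat.eq_zero_or_pos (Nat.find hE) with hz | hz
    · rw [hz]; simp only [cfQ]; omega
    · have := Nat.find_min hE (Nat.sub_lt hz one_pos)
      rw [show Nat.find hE - 1 + 1 = Nat.find hE by omega] at this
      omega
  choose κ hκ1 hκ2 using hex
  refine ⟨κ, ?_, ?_⟩
  · rw [tendsto_atTop]
    intro K
    filter_upwards [eventually_ge_atTop (cfQ α K).toNat] with n hn
    by_contra hc
    push Not at hc
    have := cfQ_mono h h0 (show κ n + 1 ≤ K by omega)
    have := hκ2 n
    omega
  · intro n x hx
    rw [sum_eq_cnt]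
    have i0 : 0 ≤ Set.indicator (undet α 0) (fun _ => (1:ℝ)) x :=
      Set.indicator_nonneg (fun _ _ => zero_le_one) x
    have i1 : Set.indicator (undet α 0) (fun _ => (1:ℝ)) x ≤ 1 :=
      Set.indicator_le_self' (s := undet α 0) (f := fun _ => (1:ℝ)) (fun _ _ => zero_le_one) x
    have a1 := hκ1 n
    have a2 := hκ2 n
    have b1 := cnt_mono (α := α) x (show tm α (κ n) ≤ n + 1 by unfold tm; omega)
    have b2 := cnt_mono (α := α) x (show n + 1 ≤ tm α (κ n + 1) by unfold tm; omega)
    have c1 := cnt_lower h h0 hx (κ n)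
    have c2 := cnt_upper h h0 hx (κ n)
    constructor <;> linarith

lemma avg_bounds (α : ℝ) (n : ℕ) (lo hi : ℝ)
    (hb : ∀ x ∈ Ico (0:ℝ) 1,
      lo ≤ ∑ j ∈ Finset.Icc 1 n, Set.indicator (undet α j) (fun _ => (1:ℝ)) x ∧
      ∑ j ∈ Finset.Icc 1 n, Set.indicator (undet α j) (fun _ => (1:ℝ)) x ≤ hi) :
    lo ≤ ∑ j ∈ Finset.Icc 1 n, (volume (undet α j)).toReal ∧
      ∑ j ∈ Finset.Icc 1 n, (volume (undet α j)).toReal ≤ hi := by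
  have hi1 : ∀ j, IntegrableOn (Set.indicator (undet α j) (fun _ => (1:ℝ))) (Ico (0:ℝ) 1) volume :=
    fun j => (integrable_const (1:ℝ)).indicator (undet_meas α j)
  have hint : ∑ j ∈ Finset.Icc 1 n, (volume (undet α j)).toReal
      = ∫ x in Ico (0:ℝ) 1, ∑ j ∈ Finset.Icc 1 n, Set.indicator (undet α j) (fun _ => (1:ℝ)) x := by
    rw [integral_finsetSum _ (fun j _ => hi1 j)]
    refine Finset.sum_congr rfl fun j _ => ?_
    rw [setIntegral_indicator (undet_meas α j), setIntegral_const, smul_eq_mul, mul_one,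
      measureReal_def, Set.inter_eq_self_of_subset_right (fun x hx => hx.1)]
  have hI : IntegrableOn (fun x => ∑ j ∈ Finset.Icc 1 n, Set.indicator (undet α j) (fun _ => (1:ℝ)) x)
      (Ico (0:ℝ) 1) volume := integrable_finsetSum _ (fun j _ => hi1 j)
  have hc : ∀ c : ℝ, ∫ _ in Ico (0:ℝ) 1, c = c := fun c => by
    rw [setIntegral_const, measureReal_def, Real.volume_Ico]; simp
  rw [hint]
  constructor
  · rw [← hc lo]
    exact setIntegral_mono_on (integrableOn_const (by simp)) hI measurableSet_Ico
      fun x hx => (hb x hx).1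
  · rw [← hc hi]
    exact setIntegral_mono_on hI (integrableOn_const (by simp)) measurableSet_Ico
      fun x hx => (hb x hx).2

lemma log_ratio (κ : ℕ → ℕ) (hκ : Tendsto κ atTop atTop) (u : ℕ → ℝ) (g : ℕ → ℝ)
    (hg : ∀ r : ℝ, 1 < r → ∃ C : ℝ, 0 < C ∧ ∀ k : ℕ, 1 ≤ k → g k ≤ C * (k:ℝ) ^ r)
    (h1 : ∀ n, ((κ n : ℝ) - 6) / 2 ≤ u n) (h2 : ∀ n, u n ≤ g (κ n)) :
    Tendsto (fun n => Real.log (u n) / Real.log (κ n)) atTop (nhds 1) := by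
  have hlog : Tendsto (fun n => Real.log (κ n : ℝ)) atTop atTop :=
    Real.tendsto_log_atTop.comp (tendsto_natCast_atTop_atTop.comp hκ)
  have hsmall : ∀ c : ℝ, Tendsto (fun n => c / Real.log (κ n : ℝ)) atTop (nhds 0) :=
    fun c => tendsto_const_nhds.div_atTop hlog
  rw [tendsto_order]
  constructor
  · intro a ha
    filter_upwards [hκ.eventually_ge_atTop 12, hlog.eventually_gt_atTop 0,
      (hsmall (Real.log 4)).eventually (gt_mem_nhds (show 0 < 1 - a by linarith))] with n hn hp hs
    have hn' : (12:ℝ) ≤ κ n := by exact_mod_cast hn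
    have e : (κ n : ℝ) / 4 ≤ u n := by linarith [h1 n]
    have e2 := Real.log_le_log (by positivity) e
    rw [Real.log_div (by positivity) (by norm_num)] at e2
    rw [div_lt_iff₀ hp] at hs
    rw [lt_div_iff₀ hp]
    nlinarith
  · intro b hb
    obtain ⟨C, hC, hk⟩ := hg ((1 + b) / 2) (by linarith)
    filter_upwards [hκ.eventually_ge_atTop 12, hlog.eventually_gt_atTop 0,
      (hsmall (Real.log C)).eventually (gt_mem_nhds (show 0 < (b - 1) / 2 by linarith))] with n hn hp hs
    have hn' : (12:ℝ) ≤ κ n := by exact_mod_cast hn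
    have e : u n ≤ C * (κ n : ℝ) ^ ((1 + b) / 2) := (h2 n).trans (hk _ (by omega))
    have e2 := Real.log_le_log (by linarith [h1 n]) e
    rw [Real.log_mul hC.ne' (by positivity), Real.log_rpow (by positivity)] at e2
    rw [div_lt_iff₀ hp] at hs
    rw [div_lt_iff₀ hp]
    nlinarith

theorem stmt7 :
    ∀ᵐ α ∂(volume.restrict (Set.Ioo (0:ℝ) 1)), Irrational α →
      ∀ᵐ x ∂(volume.restrict (Set.Ico (0:ℝ) 1)),
        Tendsto (fun n =>
            Real.log (∑ j ∈ Finset.Icc 1 n, Set.indicator (undet α j) (fun _ => (1:ℝ)) x) /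
            Real.log (∑ j ∈ Finset.Icc 1 n, (volume (undet α j)).toReal))
          atTop (nhds 1) := by
  filter_upwards [growth, ae_restrict_mem measurableSet_Ioo] with α hgr h0 h
  have hg' := hgr h h0
  have hg : ∀ r : ℝ, 1 < r → ∃ C : ℝ, 0 < C ∧ ∀ k : ℕ, 1 ≤ k →
      ∑ m ∈ Finset.range k, 2 * (1 / gm^[m] α) ≤ C * (k:ℝ) ^ r := by
    intro r hr
    obtain ⟨C, hC, hk⟩ := hg' r hr
    refine ⟨2 * C, by positivity, fun k hk1 => ?_⟩
    rw [← Finset.mul_sum, mul_assoc]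
    exact mul_le_mul_of_nonneg_left (hk k hk1) (by norm_num)
  obtain ⟨κ, hκ, hb⟩ := both_bounds h h0
  filter_upwards [ae_restrict_mem measurableSet_Ico] with x hx
  have hE := fun n => avg_bounds α n _ _ (hb n)
  have t1 := log_ratio κ hκ _ _ hg (fun n => (hb n x hx).1) (fun n => (hb n x hx).2)
  have t2 := log_ratio κ hκ _ _ hg (fun n => (hE n).1) (fun n => (hE n).2)
  have t3 := t1.div t2 one_ne_zero
  rw [div_one] at t3
  refine t3.congr' ?_
  filter_upwards [hκ.eventually_ge_atTop 12] with n hn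
  have hn' : (12:ℝ) ≤ κ n := by exact_mod_cast hn
  have : Real.log (κ n : ℝ) ≠ 0 := (Real.log_pos (by linarith)).ne'
  simp only [Pi.div_apply]
  exact div_div_div_cancel_right₀ this _ _
end
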